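/- arXiv:0801.1904 — 3 statements merged into one kernel-verified Lean document; each statement's English description precedes it below -/
import Mathlib

section
/- Let X be a metrizable space, Y a metrizable C-space, and f : X → Y an open perfect surjection (continuous, closed, with compact fibers) such that each fiber f⁻¹(y) is dense in itself (has no isolated points). Let 𝒻(f) = {H : H is a nonempty closed subset of X with f(H) = Y}, considered as a subspace of the hyperspace of nonempty closed subsets of X with the Vietoris topology. Then the set 𝒻₀(f) = {H ∈ 𝒻(f) : H is zero-dimensional} is dense in 𝒻(f) with respect to the Vietoris topology. -/
open Set Topology Filter

/-- A topological space `Y` is a C-space if for every sequence of open covers `W n`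
there is a sequence `V n` of pairwise disjoint open families such that each `V n`
refines `W n` and the union of all `V n` is a cover. -/
def IsCSpace (Y : Type*) [TopologicalSpace Y] : Prop :=
  ∀ W : ℕ → Set (Set Y),
    (∀ n, (∀ U ∈ W n, IsOpen U) ∧ ⋃₀ W n = Set.univ) →
    ∃ V : ℕ → Set (Set Y),
      (∀ n, (∀ U ∈ V n, IsOpen U) ∧ (V n).Pairwise Disjoint ∧
        ∀ U ∈ V n, ∃ W' ∈ W n, U ⊆ W') ∧
      ⋃₀ (⋃ n, V n) = Set.univ

/-- A subset `A ⊆ X` is C*-embedded if every bounded continuous real-valued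
function on `A` extends continuously to `X`. -/
def CStarEmbedded {X : Type*} [TopologicalSpace X] (A : Set X) : Prop :=
  ∀ g : C(A, ℝ), (∃ M : ℝ, ∀ a : A, |g a| ≤ M) →
    ∃ G : C(X, ℝ), ∀ a : A, G a = g a

/-- A space has covering dimension zero: every finite open cover admits a finite
refinement by pairwise disjoint open sets covering the space. -/
def CovDimZero (Z : Type*) [TopologicalSpace Z] : Prop :=
  ∀ 𝒰 : Finset (Set Z), (∀ U ∈ 𝒰, IsOpen U) → ⋃₀ (𝒰 : Set (Set Z)) = Set.univ →
    ∃ 𝒱 : Finset (Set Z), (∀ V ∈ 𝒱, IsOpen V) ∧ Set.Pairwise {V : Set Z | V ∈ 𝒱} Disjoint ∧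
      (∀ V ∈ 𝒱, ∃ U ∈ 𝒰, V ⊆ U) ∧ ⋃₀ (𝒱 : Set (Set Z)) = Set.univ

/-- The hyperspace `𝒻(X)` of nonempty closed subsets of `X`. -/
structure Hyper (X : Type*) [TopologicalSpace X] where
  carrier : Set X
  isClosed' : IsClosed carrier
  nonempty' : carrier.Nonempty

/-- The Vietoris topology on `𝒻(X)`, generated by the sets
`⟨𝒱⟩ = {S : S ⊆ ⋃𝒱 and S ∩ V ≠ ∅ for all V ∈ 𝒱}` for finite families `𝒱` of open sets. -/
instance Hyper.instTopologicalSpace (X : Type*) [TopologicalSpace X] :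
    TopologicalSpace (Hyper X) :=
  TopologicalSpace.generateFrom
    {T : Set (Hyper X) | ∃ 𝒱 : Finset (Set X), (∀ V ∈ 𝒱, IsOpen V) ∧
      T = {S : Hyper X | S.carrier ⊆ ⋃₀ (𝒱 : Set (Set X)) ∧
        ∀ V ∈ 𝒱, (S.carrier ∩ V).Nonempty}}

theorem hyper_nbhd {X : Type*} [TopologicalSpace X] {O : Set (Hyper X)} (hO : IsOpen O) :
    ∀ H₀ ∈ O, ∃ U : Set X, IsOpen U ∧ H₀.carrier ⊆ U ∧ ∃ P : Set X, P.Finite ∧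
      P ⊆ H₀.carrier ∧ ∀ S : Hyper X, P ⊆ S.carrier → S.carrier ⊆ U → S ∈ O := by
  change TopologicalSpace.GenerateOpen _ O at hO
  induction hO with
  | basic T hT =>
    obtain ⟨𝒱, h𝒱, rfl⟩ := hT
    rintro H₀ ⟨h1, h2⟩
    haveI : Nonempty X := ⟨H₀.nonempty'.some⟩
    choose! p hp using h2
    refine ⟨⋃₀ (𝒱 : Set (Set X)), isOpen_sUnion h𝒱, h1, p '' (𝒱 : Set (Set X)),
      𝒱.finite_toSet.image p, ?_, ?_⟩
    · rintro _ ⟨V, hV, rfl⟩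
      exact (hp V hV).1
    · intro S hPS hSU
      exact ⟨hSU, fun V hV => ⟨p V, hPS ⟨V, hV, rfl⟩, (hp V hV).2⟩⟩
  | univ =>
    intro H₀ _
    exact ⟨univ, isOpen_univ, subset_univ _, ∅, finite_empty, empty_subset _,
      fun _ _ _ => mem_univ _⟩
  | inter A B _ _ ihA ihB =>
    rintro H₀ ⟨hA, hB⟩
    obtain ⟨U, hU, hHU, P, hP, hPH, h⟩ := ihA H₀ hA
    obtain ⟨U', hU', hHU', P', hP', hPH', h'⟩ := ihB H₀ hB
    exact ⟨U ∩ U', hU.inter hU', subset_inter hHU hHU', P ∪ P', hP.union hP',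
      union_subset hPH hPH', fun S h1 h2 =>
        ⟨h S (subset_union_left.trans h1) (h2.trans inter_subset_left),
         h' S (subset_union_right.trans h1) (h2.trans inter_subset_right)⟩⟩
  | sUnion 𝒜 _ ih =>
    rintro H₀ ⟨A, hA, hH⟩
    obtain ⟨U, hU, hHU, P, hP, hPH, h⟩ := ih A hA H₀ hH
    exact ⟨U, hU, hHU, P, hP, hPH, fun S h1 h2 => ⟨A, hA, h S h1 h2⟩⟩

/-- Existence of arbitrarily fine disjoint open families covering `F`. -/
def SmallPart {X : Type*} [MetricSpace X] (F : Set X) : Prop :=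
  ∀ ε > (0 : ℝ), ∃ 𝒬 : Set (Set X), (∀ P ∈ 𝒬, IsOpen P) ∧ 𝒬.Pairwise Disjoint ∧
    F ⊆ ⋃₀ 𝒬 ∧ ∀ P ∈ 𝒬, ∀ x ∈ P, ∀ y ∈ P, dist x y < ε

theorem SmallPart.insert {X : Type*} [MetricSpace X] {F : Set X} (hF : SmallPart F)
    (hc : IsClosed F) (p : X) : SmallPart (insert p F) := by
  by_cases hp : p ∈ F
  · rwa [insert_eq_of_mem hp]
  intro ε hε
  obtain ⟨𝒬, h1, h2, h3, h4⟩ := hF ε hε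
  obtain ⟨δ, hδ, hδF⟩ := Metric.isOpen_iff.1 hc.isOpen_compl p hp
  set r := min (δ / 2) (ε / 2) with hr
  have hr0 : 0 < r := by positivity
  have hr1 : r ≤ δ / 2 := min_le_left _ _
  have hr2 : r ≤ ε / 2 := min_le_right _ _
  refine ⟨Insert.insert (Metric.ball p r) ((fun P => P \ Metric.closedBall p r) '' 𝒬),
    ?_, ?_, ?_, ?_⟩
  · rintro P (rfl | ⟨Q, hQ, rfl⟩)
    · exact Metric.isOpen_ball
    · exact (h1 Q hQ).sdiff Metric.isClosed_closedBall
  · have key : ∀ Q : Set X, Disjoint (Metric.ball p r) (Q \ Metric.closedBall p r) := fun Q =>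
      disjoint_sdiff_right.mono_left Metric.ball_subset_closedBall
    rintro P (rfl | ⟨Q, hQ, rfl⟩) P' (rfl | ⟨Q', hQ', rfl⟩) hne
    · exact absurd rfl hne
    · exact key Q'
    · exact (key Q).symm
    · have : Q ≠ Q' := by rintro rfl; exact hne rfl
      exact (h2 hQ hQ' this).mono sdiff_subset sdiff_subset
  · rintro x (rfl | hx)
    · exact ⟨_, mem_insert _ _, Metric.mem_ball_self hr0⟩
    · obtain ⟨P, hP, hxP⟩ := h3 hx
      refine ⟨_, mem_insert_of_mem _ ⟨P, hP, rfl⟩, hxP, fun hxb => ?_⟩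
      refine hδF ?_ hx
      rw [Metric.mem_ball]
      have := Metric.mem_closedBall.1 hxb
      linarith
  · rintro P (rfl | ⟨Q, hQ, rfl⟩) x hx y hy
    · have := dist_triangle_right x y p
      rw [Metric.mem_ball] at hx hy
      linarith
    · exact h4 Q hQ x hx.1 y hy.1

theorem SmallPart.union_finite {X : Type*} [MetricSpace X] {F P : Set X} (hF : SmallPart F)
    (hc : IsClosed F) (hP : P.Finite) : SmallPart (P ∪ F) ∧ IsClosed (P ∪ F) := by
  refine ⟨?_, hP.isClosed.union hc⟩
  induction P, hP using Set.Finite.induction_on with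
  | empty => simpa using hF
  | @insert a s _ hs ih =>
    rw [insert_union]
    exact ih.insert (hs.isClosed.union hc) a

theorem SmallPart.covDimZero {X : Type*} [MetricSpace X] {F : Set X} (hF : SmallPart F) :
    CovDimZero ↥F := by
  classical
  intro 𝒰 hU hcov
  have hpos : ∀ n : ℕ, (0 : ℝ) < 1 / ((n : ℝ) + 1) := fun n => Nat.one_div_pos_of_nat
  choose 𝒬 h1 h2 h3 h4 using fun n : ℕ => hF _ (hpos n)
  set c : ℕ → F → Set F := fun n z =>
    {w | ∀ m ≤ n, ∀ P ∈ 𝒬 m, (z : X) ∈ P ↔ (w : X) ∈ P} with hc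
  have cself : ∀ n z, z ∈ c n z := fun n z m _ P _ => Iff.rfl
  have cmono : ∀ n m z, m ≤ n → c n z ⊆ c m z := fun n m z hmn w hw k hk P hP =>
    hw k (hk.trans hmn) P hP
  have ceq : ∀ n z w, w ∈ c n z → c n w = c n z := by
    intro n z w hw
    ext v
    exact forall_congr' fun m => forall_congr' fun hm => forall_congr' fun P =>
      forall_congr' fun hP => by rw [hw m hm P hP]
  have cnhds : ∀ n z, c n z ∈ 𝓝 z := by
    intro n z
    have : ∀ m, ∀ᶠ w : F in 𝓝 z, ∀ P ∈ 𝒬 m, (z : X) ∈ P ↔ (w : X) ∈ P := by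
      intro m
      obtain ⟨Q, hQ, hzQ⟩ := h3 m z.2
      have : ((↑) : F → X) ⁻¹' Q ∈ 𝓝 z :=
        ((h1 m Q hQ).preimage continuous_subtype_val).mem_nhds hzQ
      filter_upwards [this] with w hw P hP
      by_cases hPQ : P = Q
      · subst hPQ; exact ⟨fun _ => hw, fun _ => hzQ⟩
      · have hd := h2 m hP hQ hPQ
        exact ⟨fun h => absurd hzQ (Set.disjoint_left.1 hd h),
          fun h => absurd hw (Set.disjoint_left.1 hd h)⟩
    have := (Filter.eventually_all_finite (finite_Iic n)).2 fun m _ => this m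
    exact this
  have cdist : ∀ n z w, w ∈ c n z → dist z w < 1 / ((n : ℝ) + 1) := by
    intro n z w hw
    obtain ⟨Q, hQ, hzQ⟩ := h3 n z.2
    exact h4 n Q hQ z hzQ w ((hw n le_rfl Q hQ).1 hzQ)
  have hex : ∀ z, ∃ n, ∃ U ∈ 𝒰, c n z ⊆ U := by
    intro z
    obtain ⟨U, hUU, hzU⟩ : z ∈ ⋃₀ (𝒰 : Set (Set F)) := hcov ▸ mem_univ z
    obtain ⟨ε, hε, hb⟩ := Metric.isOpen_iff.1 (hU U hUU) z hzU
    obtain ⟨n, hn⟩ := exists_nat_one_div_lt hε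
    refine ⟨n, U, hUU, fun w hw => hb ?_⟩
    rw [Metric.mem_ball']
    exact (cdist n z w hw).trans hn
  set N : F → ℕ := fun z => Nat.find (hex z) with hN
  have hNs : ∀ z, ∃ U ∈ 𝒰, c (N z) z ⊆ U := fun z => Nat.find_spec (hex z)
  set ch : Set F → Set F := fun A => if h : ∃ U ∈ 𝒰, A ⊆ U then h.choose else ∅ with hch
  set φ : F → Set F := fun z => ch (c (N z) z) with hφ
  have hφ1 : ∀ z, φ z ∈ 𝒰 ∧ c (N z) z ⊆ φ z := by
    intro z
    have : φ z = (hNs z).choose := dif_pos (hNs z)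
    rw [this]
    exact (hNs z).choose_spec
  have hφ2 : ∀ z w, w ∈ c (N z) z → φ w = φ z := by
    intro z w hw
    have hNN : N w = N z := by
      apply le_antisymm
      · apply Nat.find_min'
        rw [ceq _ _ _ hw]
        exact hNs z
      · apply Nat.find_min'
        by_cases hle : N w ≤ N z
        · have := ceq _ _ _ (cmono _ _ z hle hw)
          rw [← this]
          exact hNs w
        · obtain ⟨U, hU1, hU2⟩ := hNs z
          exact ⟨U, hU1, by
            have := Nat.find_min' (hex w) (m := N z) ⟨U, hU1, by rw [ceq _ _ _ hw]; exact hU2⟩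
            exact absurd this hle⟩
    change ch (c (N w) w) = ch (c (N z) z)
    rw [hNN, ceq _ _ _ hw]
  refine ⟨𝒰.image fun U => φ ⁻¹' {U}, ?_, ?_, ?_, ?_⟩
  · intro V hV
    obtain ⟨U, hUU, rfl⟩ := Finset.mem_image.1 hV
    rw [isOpen_iff_mem_nhds]
    intro z hz
    filter_upwards [cnhds (N z) z] with w hw
    exact (hφ2 z w hw).trans hz
  · intro V hV V' hV' hne
    obtain ⟨U, hUU, rfl⟩ := Finset.mem_image.1 hV
    obtain ⟨U', hUU', rfl⟩ := Finset.mem_image.1 hV'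
    rw [Set.disjoint_left]
    intro z hz hz'
    apply hne
    have : U = U' := (show φ z = U from hz).symm.trans hz'
    rw [this]
  · intro V hV
    obtain ⟨U, hUU, rfl⟩ := Finset.mem_image.1 hV
    refine ⟨U, hUU, fun z hz => ?_⟩
    rw [← (show φ z = U from hz)]
    exact (hφ1 z).2 (cself _ z)
  · rw [eq_univ_iff_forall]
    intro z
    exact ⟨φ ⁻¹' {φ z}, Finset.mem_coe.2 (Finset.mem_image.2 ⟨φ z, (hφ1 z).1, rfl⟩), rfl⟩

open BoundedContinuousFunction in
/-- `g` is not constant on the part of the fiber of `f` over `y` lying in `R`. -/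
def NonConst {X Y : Type*} [TopologicalSpace X] (f : X → Y) (R : Set X) (y : Y) (g : X →ᵇ ℝ) :
    Prop :=
  ∃ x₁ ∈ R, ∃ x₂ ∈ R, f x₁ = y ∧ f x₂ = y ∧ g x₁ ≠ g x₂

open BoundedContinuousFunction in
theorem NonConst.eventually {X Y : Type*} [TopologicalSpace X] [TopologicalSpace Y]
    {f : X → Y} (hopen : IsOpenMap f) {R : Set X} (hR : IsOpen R) {y : Y} {g : X →ᵇ ℝ}
    (h : NonConst f R y g) : ∀ᶠ p : Y × (X →ᵇ ℝ) in 𝓝 (y, g), NonConst f R p.1 p.2 := by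
  obtain ⟨x₁, hx₁, x₂, hx₂, h1, h2, hne⟩ := h
  obtain ⟨A₁, A₂, hA₁, hA₂, hm₁, hm₂, hd⟩ := t2_separation hne
  have key : ∀ x ∈ R, f x = y → ∀ A : Set ℝ, IsOpen A → g x ∈ A →
      ∀ᶠ p : Y × (X →ᵇ ℝ) in 𝓝 (y, g), ∃ x' ∈ R, f x' = p.1 ∧ p.2 x' ∈ A := by
    intro x hx hxy A hA hgA
    have hev : ∀ᶠ q : (X →ᵇ ℝ) × X in 𝓝 (g, x), q.1 q.2 ∈ A :=
      (ContinuousEval.continuous_eval (F := X →ᵇ ℝ) (X := X) (Y := ℝ)).continuousAt.eventually (hA.mem_nhds hgA)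
    rw [nhds_prod_eq] at hev
    obtain ⟨G, hG, B, hB, hGB⟩ := Filter.eventually_prod_iff.1 hev
    have hB' : {x' | B x' ∧ x' ∈ R} ∈ 𝓝 x := hB.and (hR.mem_nhds hx)
    have hI := hopen.image_mem_nhds hB'
    rw [hxy] at hI
    rw [nhds_prod_eq]
    filter_upwards [Filter.prod_mem_prod hI hG] with p hp
    obtain ⟨⟨x', ⟨hx'B, hx'R⟩, hx'⟩, hpG⟩ := hp
    exact ⟨x', hx'R, hx', hGB hpG hx'B⟩
  filter_upwards [key x₁ hx₁ h1 A₁ hA₁ hm₁, key x₂ hx₂ h2 A₂ hA₂ hm₂] with p hp hp'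
  obtain ⟨z, hz, hz1, hz2⟩ := hp
  obtain ⟨z', hz', hz1', hz2'⟩ := hp'
  refine ⟨z, hz, z', hz', hz1, hz1', fun he => ?_⟩
  rw [he] at hz2
  exact Set.disjoint_left.1 hd hz2 hz2'

open BoundedContinuousFunction in
theorem exists_generic {X Y : Type*} [MetricSpace X]
    (f : X → Y) {R : Set X} (hR : IsOpen R) (y : Y) {x₀ : X} (hx₀ : x₀ ∈ R) (hfx : f x₀ = y)
    (hacc : AccPt x₀ (𝓟 (f ⁻¹' {y}))) {K : Set (X →ᵇ ℝ)} (hK : IsCompact K) :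
    ∃ h : X →ᵇ ℝ, NonConst f R y h ∧
      ∀ k ∈ K, ∀ t : ℝ, 0 < t → t ≤ 1 → NonConst f R y ((1 - t) • k + t • h) := by
  set K' := insert (0 : X →ᵇ ℝ) K with hK'
  have hK'c : IsCompact K' := hK.insert 0
  set m : X → ℝ := fun x => sSup ((fun k : X →ᵇ ℝ => |k x - k x₀|) '' K') with hm
  have hev : Continuous fun p : X × (X →ᵇ ℝ) => p.2 p.1 :=
    (ContinuousEval.continuous_eval (F := X →ᵇ ℝ) (X := X) (Y := ℝ)).comp continuous_swap
  have hmc : Continuous m := by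
    apply IsCompact.continuous_sSup hK'c
    have h2 : Continuous fun p : X × (X →ᵇ ℝ) => p.2 x₀ :=
      hev.comp (continuous_const.prodMk continuous_snd)
    exact (hev.sub h2).abs
  have hle : ∀ k ∈ K', ∀ x, |k x - k x₀| ≤ m x := by
    intro k hk x
    refine le_csSup ?_ (mem_image_of_mem (fun k : X →ᵇ ℝ => |k x - k x₀|) hk)
    apply (hK'c.image _).bddAbove
    have h1 : Continuous fun k : X →ᵇ ℝ => k x := hev.comp (continuous_const.prodMk continuous_id)
    have h2 : Continuous fun k : X →ᵇ ℝ => k x₀ := hev.comp (continuous_const.prodMk continuous_id)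
    exact (h1.sub h2).abs
  have hm0 : ∀ x, 0 ≤ m x := fun x => (abs_nonneg _).trans (hle 0 (mem_insert _ _) x)
  have hmx : m x₀ = 0 := by
    have : (fun k : X →ᵇ ℝ => |k x₀ - k x₀|) '' K' = {0} := by
      ext r; constructor
      · rintro ⟨k, _, rfl⟩; simp
      · rintro rfl; exact ⟨0, mem_insert _ _, by simp⟩
    simp only [hm, this, csSup_singleton]
  set hh : X → ℝ := fun x => min 1 (Real.sqrt (m x) + dist x x₀) with hhh
  have hhc : Continuous hh := by fun_prop
  have hh0 : ∀ x, 0 ≤ hh x := fun x => by simp only [hhh]; positivity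
  let h : X →ᵇ ℝ := BoundedContinuousFunction.ofNormedAddCommGroup hh hhc 1 fun x => by
    rw [Real.norm_eq_abs, abs_of_nonneg (hh0 x)]; exact min_le_left _ _
  have hcoe : ∀ x, h x = hh x := fun x => rfl
  have hhx : h x₀ = 0 := by rw [hcoe]; simp [hhh, hmx]
  have key : ∀ k ∈ K', ∀ t : ℝ, 0 < t → t ≤ 1 → NonConst f R y ((1 - t) • k + t • h) := by
    intro k hk t ht ht1
    have e1 : ∀ᶠ x in 𝓝 x₀, m x < t ^ 2 :=
      hmc.continuousAt.eventually_lt continuousAt_const (by rw [hmx]; positivity)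
    have e2 : ∀ᶠ x in 𝓝 x₀, Real.sqrt (m x) + dist x x₀ < 1 := by
      have : Continuous fun x => Real.sqrt (m x) + dist x x₀ := by fun_prop
      exact this.continuousAt.eventually_lt continuousAt_const (by simp [hmx])
    have e3 : ∀ᶠ x in 𝓝 x₀, x ∈ R := hR.mem_nhds hx₀
    obtain ⟨x, ⟨hne, hxf⟩, hx1, hx2, hx3⟩ :=
      ((accPt_iff_frequently.1 hacc).and_eventually (e1.and (e2.and e3))).exists
    refine ⟨x, hx3, x₀, hx₀, hxf, hfx, fun heq => ?_⟩
    have hval : h x = Real.sqrt (m x) + dist x x₀ := by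
      rw [hcoe]; exact min_eq_right hx2.le
    simp only [BoundedContinuousFunction.coe_add, BoundedContinuousFunction.coe_smul,
      Pi.add_apply, smul_eq_mul, hhx, hval] at heq
    have hd : 0 < dist x x₀ := dist_pos.2 hne
    have hs : Real.sqrt (m x) < t := (Real.sqrt_lt' ht).2 hx1
    have hs2 : Real.sqrt (m x) * Real.sqrt (m x) = m x := Real.mul_self_sqrt (hm0 x)
    have hs0 := Real.sqrt_nonneg (m x)
    have hb := (abs_le.1 (hle k hk x)).1
    have hb2 : (1 - t) * (k x₀ - k x) ≤ m x := by
      have := hm0 x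
      nlinarith
    nlinarith [mul_pos ht hd]
  refine ⟨h, ?_, fun k hk => key k (mem_insert_of_mem _ hk)⟩
  have := key 0 (mem_insert _ _) 1 one_pos le_rfl
  simpa using this

open BoundedContinuousFunction in
/-- A stage of the construction. -/
structure IsStage {X Y : Type*} [TopologicalSpace X] [TopologicalSpace Y] (f : X → Y) (R : Set X)
    (K : Y → Set (X →ᵇ ℝ)) : Prop where
  cpt : ∀ y, IsCompact (K y)
  dec : ∀ y, ∀ᶠ y' in 𝓝 y, K y' ⊆ K y
  nc : ∀ y, ∀ k ∈ K y, NonConst f R y k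

open BoundedContinuousFunction in
theorem stage_step {X Y : Type*} [MetricSpace X] [MetricSpace Y]
    (f : X → Y) (hopen : IsOpenMap f)
    (hdense : ∀ y : Y, ∀ x ∈ f ⁻¹' {y}, AccPt x (𝓟 (f ⁻¹' {y})))
    {R : Set X} (hR : IsOpen R) (hRs : f '' R = univ)
    (K : Y → Set (X →ᵇ ℝ)) (hK : IsStage f R K) :
    ∃ (K' : Y → Set (X →ᵇ ℝ)) (W : Y → Set Y) (h : Y → (X →ᵇ ℝ)), IsStage f R K' ∧
      (∀ y, K y ⊆ K' y) ∧ (∀ s, IsOpen (W s)) ∧ (⋃ s, W s = univ) ∧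
      ∀ s, ∀ y ∈ W s, h s ∈ K' y ∧ ∀ k ∈ K y, ∀ t : ℝ, 0 ≤ t → t ≤ 1 →
        (1 - t) • k + t • h s ∈ K' y := by
  have hpt : ∀ y, ∃ x ∈ R, f x = y := fun y => by
    have : y ∈ f '' R := hRs ▸ mem_univ y
    exact this
  choose x₀ hx₀R hx₀f using hpt
  choose h hh1 hh2 using fun y => exists_generic f hR y (hx₀R y) (hx₀f y)
    (hdense y (x₀ y) (hx₀f y)) (hK.cpt y)
  -- the joins
  set J : Y → Y → Set (X →ᵇ ℝ) := fun s y =>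
    insert (h s) ((fun p : ℝ × (X →ᵇ ℝ) => (1 - p.1) • p.2 + p.1 • h s) '' (Icc 0 1 ×ˢ K y))
    with hJ
  have hJc : ∀ s y, IsCompact (J s y) := fun s y =>
    ((isCompact_Icc.prod (hK.cpt y)).image (by fun_prop)).insert _
  have hJm : ∀ s y y', K y' ⊆ K y → J s y' ⊆ J s y := fun s y y' hs =>
    insert_subset_insert (image_mono (prod_mono_right hs))
  have hJnc : ∀ s, ∀ g ∈ J s s, NonConst f R s g := by
    rintro s g (rfl | ⟨⟨t, k⟩, ⟨ht, hk⟩, rfl⟩)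
    · exact hh1 s
    · rcases ht.1.eq_or_lt with h0 | h0
      · change (0 : ℝ) = t at h0
        subst h0
        simpa using hK.nc s k hk
      · exact hh2 s k hk t h0 ht.2
  have hJev : ∀ s, ∀ᶠ y in 𝓝 s, ∀ g ∈ J s s, NonConst f R y g := by
    intro s
    exact (hJc s s).eventually_forall_of_forall_eventually fun g hg =>
      (hJnc s g hg).eventually hopen hR
  have hN : ∀ s, ∃ N : Set Y, IsOpen N ∧ s ∈ N ∧ ∀ y ∈ N, ∀ g ∈ J s y, NonConst f R y g := by
    intro s
    obtain ⟨N, hN1, hN2, hN3⟩ := mem_nhds_iff.1 ((hJev s).and (hK.dec s))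
    exact ⟨N, hN2, hN3, fun y hy g hg => (hN1 hy).1 g (hJm s s y (hN1 hy).2 hg)⟩
  choose N hNo hNs hN using hN
  obtain ⟨u, huo, huc, hulf, huN⟩ := precise_refinement N hNo
    (eq_univ_of_forall fun y => mem_iUnion.2 ⟨y, hNs y⟩)
  obtain ⟨v, hvc, hvo, hvu⟩ := exists_iUnion_eq_closure_subset huo
    (fun y => hulf.point_finite y) huc
  have hvlf : LocallyFinite fun s => closure (v s) := hulf.subset hvu
  refine ⟨fun y => K y ∪ ⋃ s ∈ {s | y ∈ closure (v s)}, J s y, v, h, ⟨?_, ?_, ?_⟩, ?_, hvo,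
    hvc, ?_⟩
  · intro y
    exact (hK.cpt y).union ((hvlf.point_finite y).isCompact_biUnion fun s _ => hJc s y)
  · intro y
    filter_upwards [hK.dec y, hvlf.eventually_subset (fun _ => isClosed_closure) y] with y' h1 h2
    apply union_subset_union h1
    exact biUnion_mono h2 fun s _ => hJm s y y' h1
  · rintro y k (hk | hk)
    · exact hK.nc y k hk
    · obtain ⟨s, hs, hk⟩ := mem_iUnion₂.1 hk
      exact hN s y (huN s (hvu s hs)) k hk
  · intro y; exact subset_union_left
  · intro s y hy
    have : J s y ⊆ K y ∪ ⋃ s ∈ {s | y ∈ closure (v s)}, J s y :=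
      (subset_biUnion_of_mem (u := fun s => J s y)
        (show s ∈ {s | y ∈ closure (v s)} from subset_closure hy)).trans subset_union_right
    exact ⟨this (mem_insert _ _), fun k hk t h0 h1 =>
      this (mem_insert_of_mem _ ⟨(t, k), ⟨⟨h0, h1⟩, hk⟩, rfl⟩)⟩

open BoundedContinuousFunction in
theorem exists_stages {X Y : Type*} [MetricSpace X] [MetricSpace Y]
    (f : X → Y) (hopen : IsOpenMap f)
    (hdense : ∀ y : Y, ∀ x ∈ f ⁻¹' {y}, AccPt x (𝓟 (f ⁻¹' {y})))
    {R : Set X} (hR : IsOpen R) (hRs : f '' R = univ) :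
    ∃ (K : ℕ → Y → Set (X →ᵇ ℝ)) (W : ℕ → Y → Set Y) (h : ℕ → Y → (X →ᵇ ℝ)),
      (∀ n, IsStage f R (K n)) ∧ ∀ n,
      (∀ y, K n y ⊆ K (n + 1) y) ∧ (∀ s, IsOpen (W n s)) ∧ (⋃ s, W n s = univ) ∧
      ∀ s, ∀ y ∈ W n s, h n s ∈ K (n + 1) y ∧ ∀ k ∈ K n y, ∀ t : ℝ, 0 ≤ t → t ≤ 1 →
        (1 - t) • k + t • h n s ∈ K (n + 1) y := by
  choose! K' W h h1 h2 using stage_step f hopen hdense hR hRs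
  let K : ℕ → Y → Set (X →ᵇ ℝ) := fun n => Nat.rec (fun _ => ∅) (fun _ k => K' k) n
  have hK : ∀ n, IsStage f R (K n) := by
    intro n
    induction n with
    | zero => exact ⟨fun _ => isCompact_empty, fun _ => Eventually.of_forall fun _ => subset_rfl,
        fun _ _ hk => absurd hk (notMem_empty _)⟩
    | succ n ih => exact h1 (K n) ih
  exact ⟨K, fun n => W (K n), fun n => h (K n), hK, fun n => h2 (K n) (hK n)⟩

open BoundedContinuousFunction in
theorem exists_nonconst {X Y : Type*} [MetricSpace X] [MetricSpace Y] (hY : IsCSpace Y)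
    (f : X → Y) (hf : Continuous f) (hopen : IsOpenMap f)
    (hdense : ∀ y : Y, ∀ x ∈ f ⁻¹' {y}, AccPt x (𝓟 (f ⁻¹' {y})))
    {R : Set X} (hR : IsOpen R) (hRs : f '' R = univ) :
    ∃ g : X → ℝ, Continuous g ∧ ∀ y, ∃ x₁ ∈ R, ∃ x₂ ∈ R, f x₁ = y ∧ f x₂ = y ∧ g x₁ < g x₂ := by
  rcases isEmpty_or_nonempty Y with hYe | hYe
  · exact ⟨fun _ => 0, continuous_const, fun y => isEmptyElim y⟩
  obtain ⟨K, W, h, hK, hS⟩ := exists_stages f hopen hdense hR hRs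
  obtain ⟨V, hV, hVc⟩ := hY (fun n => range (W n)) fun n => by
    refine ⟨?_, ?_⟩
    · rintro _ ⟨s, rfl⟩; exact (hS n).2.1 s
    · rw [sUnion_range]; exact (hS n).2.2.1
  have hVs : ∀ n, ∀ U ∈ V n, ∃ s, U ⊆ W n s := by
    intro n U hU
    obtain ⟨_, ⟨s, rfl⟩, hs⟩ := (hV n).2.2 U hU
    exact ⟨s, hs⟩
  choose! s hs using hVs
  have hvex : ∀ n, ∀ y ∈ ⋃₀ V n, ∃ U ∈ V n, y ∈ U := fun n y hy => hy
  choose! v hvV hvy using hvex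
  set H : ℕ → Y → (X →ᵇ ℝ) := fun n y => h n (s n (v n y)) with hH
  have hHW : ∀ n, ∀ y ∈ ⋃₀ V n, y ∈ W n (s n (v n y)) := fun n y hy =>
    hs n _ (hvV n y hy) (hvy n y hy)
  have hHc : ∀ n, ∀ y ∈ ⋃₀ V n, ContinuousAt (H n) y := by
    intro n y hy
    have hn : v n y ∈ 𝓝 y := ((hV n).1 _ (hvV n y hy)).mem_nhds (hvy n y hy)
    have : H n =ᶠ[𝓝 y] fun _ => H n y := by
      filter_upwards [hn] with y' hy'
      have hy'' : y' ∈ ⋃₀ V n := ⟨_, hvV n y hy, hy'⟩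
      have : v n y' = v n y := by
        by_contra hne
        exact Set.disjoint_left.1 ((hV n).2.1 (hvV n y' hy'') (hvV n y hy) hne) (hvy n y' hy'') hy'
      simp only [hH, this]
    exact continuousAt_const.congr this.symm
  obtain ⟨ρ, hρ⟩ := PartitionOfUnity.exists_isSubordinate (s := (univ : Set Y)) isClosed_univ
    (fun n => ⋃₀ V n) (fun n => isOpen_sUnion (hV n).1) (by
      rw [← sUnion_iUnion, hVc])
  set G : Y → (X →ᵇ ℝ) := fun y => ∑ᶠ n, ρ n y • H n y with hG
  have hGc : Continuous G := ρ.continuous_finsum_smul fun n y hy => hHc n y (hρ n hy)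
  have hρV : ∀ n y, ρ n y ≠ 0 → y ∈ ⋃₀ V n := fun n y hne => hρ n (subset_tsupport _ hne)
  have hpart : ∀ y n, 0 < ∑ i ∈ Finset.range n, ρ i y → ∃ k ∈ K n y,
      ∑ i ∈ Finset.range n, ρ i y • H i y = (∑ i ∈ Finset.range n, ρ i y) • k := by
    intro y n
    induction n with
    | zero => intro h0; simp at h0
    | succ n ih =>
      rw [Finset.sum_range_succ, Finset.sum_range_succ]
      intro hpos
      set S := ∑ i ∈ Finset.range n, ρ i y with hSdef
      have hS0 : 0 ≤ S := Finset.sum_nonneg fun i _ => ρ.nonneg i y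
      have hp0 : 0 ≤ ρ n y := ρ.nonneg n y
      by_cases hp : ρ n y = 0
      · rw [hp, add_zero] at hpos
        obtain ⟨k, hk, hke⟩ := ih hpos
        refine ⟨k, (hS n).1 y hk, ?_⟩
        rw [hp, hke]; simp
      have hyW := hHW n y (hρV n y hp)
      obtain ⟨hm1, hm2⟩ := (hS n).2.2.2 _ y hyW
      rcases hS0.eq_or_lt with h0 | h0
      · refine ⟨H n y, hm1, ?_⟩
        have hz : ∀ i ∈ Finset.range n, ρ i y = 0 :=
          (Finset.sum_eq_zero_iff_of_nonneg fun i _ => ρ.nonneg i y).1 h0.symm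
        rw [Finset.sum_eq_zero fun i hi => by rw [hz i hi, zero_smul], ← h0, zero_add, zero_add]
      · obtain ⟨k, hk, hke⟩ := ih h0
        refine ⟨_, hm2 k hk (ρ n y / (S + ρ n y)) (by positivity)
          ((div_le_one hpos).2 (by linarith)), ?_⟩
        rw [hke, smul_add, smul_smul, smul_smul]
        congr 2
        · field_simp; ring
        · field_simp
  have hGK : ∀ y, NonConst f R y (G y) := by
    intro y
    have hfin := ρ.locallyFinite.point_finite y
    obtain ⟨N, hN⟩ := hfin.bddAbove
    have hsub : ∀ i, ρ i y ≠ 0 → i ∈ Finset.range (N + 1) := fun i hi =>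
      Finset.mem_range.2 (Nat.lt_succ_of_le (hN hi))
    have hsum : ∑ i ∈ Finset.range (N + 1), ρ i y = 1 := by
      rw [← ρ.sum_eq_one (mem_univ y)]
      exact (finsum_eq_sum_of_support_subset _ fun i hi => hsub i hi).symm
    have hGe : G y = ∑ i ∈ Finset.range (N + 1), ρ i y • H i y := by
      refine finsum_eq_sum_of_support_subset _ fun i hi => hsub i fun h0 => hi ?_
      simp [h0]
    obtain ⟨k, hk, hke⟩ := hpart y (N + 1) (by rw [hsum]; exact one_pos)
    rw [hsum, one_smul] at hke
    rw [hGe, hke]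
    exact (hK (N + 1)).nc y k hk
  refine ⟨fun x => G (f x) x, ?_, ?_⟩
  · exact (ContinuousEval.continuous_eval (F := X →ᵇ ℝ) (X := X) (Y := ℝ)).comp ((hGc.comp hf).prodMk continuous_id)
  · intro y
    obtain ⟨x₁, h1, x₂, h2, e1, e2, hne⟩ := hGK y
    rcases hne.lt_or_gt with hlt | hlt
    · exact ⟨x₁, h1, x₂, h2, e1, e2, by simpa only [e1, e2] using hlt⟩
    · exact ⟨x₂, h2, x₁, h1, e2, e1, by simpa only [e1, e2] using hlt⟩

theorem exists_split {X Y : Type*} [MetricSpace X] [MetricSpace Y] (hY : IsCSpace Y)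
    (f : X → Y) (hf : Continuous f) (hopen : IsOpenMap f)
    (hdense : ∀ y : Y, ∀ x ∈ f ⁻¹' {y}, AccPt x (𝓟 (f ⁻¹' {y})))
    (R : Set X) (hR : IsOpen R ∧ f '' R = univ) :
    ∃ A B : Set X, (IsOpen A ∧ f '' A = univ) ∧ (IsOpen B ∧ f '' B = univ) ∧
      A ⊆ R ∧ B ⊆ R ∧ Disjoint A B := by
  obtain ⟨g, hg, hgn⟩ := exists_nonconst hY f hf hopen hdense hR.1 hR.2
  obtain ⟨c, hc⟩ := exists_continuous_forall_mem_convex_of_local_const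
    (t := fun y : Y => {r : ℝ | ∃ x₁ ∈ R, ∃ x₂ ∈ R, f x₁ = y ∧ f x₂ = y ∧ g x₁ < r ∧ r < g x₂})
    (by
      intro y
      apply Set.OrdConnected.convex
      refine ⟨?_⟩
      rintro a ⟨x₁, h1, -, -, e1, -, l1, -⟩ b ⟨-, -, x₂, h2, -, e2, -, l2⟩ r ⟨har, hrb⟩
      exact ⟨x₁, h1, x₂, h2, e1, e2, l1.trans_le har, hrb.trans_lt l2⟩)
    (by
      intro y
      obtain ⟨x₁, h1, x₂, h2, e1, e2, hlt⟩ := hgn y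
      obtain ⟨r, hr1, hr2⟩ := exists_between hlt
      refine ⟨r, ?_⟩
      have n1 : f '' {x | x ∈ R ∧ g x < r} ∈ 𝓝 y := by
        rw [← e1]
        exact hopen.image_mem_nhds (Filter.inter_mem (hR.1.mem_nhds h1)
          ((isOpen_lt hg continuous_const).mem_nhds hr1))
      have n2 : f '' {x | x ∈ R ∧ r < g x} ∈ 𝓝 y := by
        rw [← e2]
        exact hopen.image_mem_nhds (Filter.inter_mem (hR.1.mem_nhds h2)
          ((isOpen_lt continuous_const hg).mem_nhds hr2))
      filter_upwards [n1, n2] with y' hy1 hy2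
      obtain ⟨a, ⟨ha, ha'⟩, hay⟩ := hy1
      obtain ⟨b, ⟨hb, hb'⟩, hby⟩ := hy2
      exact ⟨a, ha, b, hb, hay, hby, ha', hb'⟩)
  have hcf : Continuous fun x => c (f x) := c.continuous.comp hf
  refine ⟨R ∩ {x | g x < c (f x)}, R ∩ {x | c (f x) < g x},
    ⟨hR.1.inter (isOpen_lt hg hcf), ?_⟩, ⟨hR.1.inter (isOpen_lt hcf hg), ?_⟩,
    inter_subset_left, inter_subset_left, ?_⟩
  · refine eq_univ_of_forall fun y => ?_
    obtain ⟨x₁, h1, x₂, h2, e1, e2, l1, l2⟩ := hc y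
    exact ⟨x₁, ⟨h1, by simpa only [mem_ofPred_eq, e1] using l1⟩, e1⟩
  · refine eq_univ_of_forall fun y => ?_
    obtain ⟨x₁, h1, x₂, h2, e1, e2, l1, l2⟩ := hc y
    exact ⟨x₂, ⟨h2, by simpa only [mem_ofPred_eq, e2] using l2⟩, e2⟩
  · rw [Set.disjoint_left]
    rintro x ⟨_, hx⟩ ⟨_, hx'⟩
    exact lt_asymm (show g x < c (f x) from hx) hx'

theorem exists_shrink {X Y : Type*} [MetricSpace X] [MetricSpace Y]
    (f : X → Y) (hf : Continuous f) (hopen : IsOpenMap f)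
    (R : Set X) (hR : IsOpen R ∧ f '' R = univ) :
    ∃ A : Set X, (IsOpen A ∧ f '' A = univ) ∧ closure A ⊆ R := by
  have hpt : ∀ y, ∃ x ∈ R, f x = y := fun y => by
    have : y ∈ f '' R := hR.2 ▸ mem_univ y
    exact this
  choose x hxR hxf using hpt
  have hO : ∀ y, ∃ O : Set X, IsOpen O ∧ x y ∈ O ∧ closure O ⊆ R := by
    intro y
    obtain ⟨C, hC, hCc, hCR⟩ := exists_mem_nhds_isClosed_subset (hR.1.mem_nhds (hxR y))
    exact ⟨interior C, isOpen_interior, mem_interior_iff_mem_nhds.2 hC,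
      (closure_minimal interior_subset hCc).trans hCR⟩
  choose O hOo hxO hOR using hO
  obtain ⟨u, huo, huc, hulf, hus⟩ := precise_refinement (fun y => f '' O y)
    (fun y => hopen _ (hOo y))
    (eq_univ_of_forall fun y => mem_iUnion.2 ⟨y, x y, hxO y, hxf y⟩)
  refine ⟨⋃ y, O y ∩ f ⁻¹' u y, ⟨isOpen_iUnion fun y => (hOo y).inter ((huo y).preimage hf), ?_⟩, ?_⟩
  · refine eq_univ_of_forall fun y => ?_
    obtain ⟨s, hs⟩ := mem_iUnion.1 (huc ▸ mem_univ y : y ∈ ⋃ s, u s)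
    obtain ⟨z, hz, hzy⟩ := hus s hs
    exact ⟨z, mem_iUnion.2 ⟨s, hz, by rw [mem_preimage, hzy]; exact hs⟩, hzy⟩
  · have : LocallyFinite fun y => O y ∩ f ⁻¹' u y :=
      (hulf.preimage_continuous hf).subset fun y => inter_subset_right
    rw [this.closure_iUnion]
    exact iUnion_subset fun y => (closure_mono inter_subset_left).trans (hOR y)

theorem exists_small {X Y : Type*} [MetricSpace X] [MetricSpace Y] (hY : IsCSpace Y)
    (f : X → Y) (hf : Continuous f) (hopen : IsOpenMap f)
    (hdense : ∀ y : Y, ∀ x ∈ f ⁻¹' {y}, AccPt x (𝓟 (f ⁻¹' {y})))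
    (ε : ℝ) (R : Set X) (hε : 0 < ε) (hR : IsOpen R ∧ f '' R = univ) :
    ∃ A : Set X, (IsOpen A ∧ f '' A = univ) ∧ closure A ⊆ R ∧
      ∃ 𝒬 : Set (Set X), (∀ P ∈ 𝒬, IsOpen P) ∧ 𝒬.Pairwise Disjoint ∧
        A ⊆ ⋃₀ 𝒬 ∧ ∀ P ∈ 𝒬, ∀ x ∈ P, ∀ y ∈ P, dist x y < ε := by
  rcases isEmpty_or_nonempty X with hXe | hXe
  · exact ⟨R, hR, fun x => isEmptyElim x, ∅, fun _ h => absurd h (notMem_empty _),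
      pairwise_empty _, fun x => isEmptyElim x, fun _ h => absurd h (notMem_empty _)⟩
  obtain ⟨R₀, hR₀, hR₀R⟩ := exists_shrink f hf hopen R hR
  choose! A B hA hB hAR hBR hAB using exists_split hY f hf hopen hdense
  let Q : ℕ → Set X := fun n => Nat.rec R₀ (fun _ k => B k) n
  have hQ : ∀ n, IsOpen (Q n) ∧ f '' Q n = univ := by
    intro n
    induction n with
    | zero => exact hR₀
    | succ n ih => exact hB (Q n) ih
  have hQanti : Antitone Q := antitone_nat_of_succ_le fun n => hBR (Q n) (hQ n)
  have hdisj : ∀ m n, m < n → Disjoint (A (Q m)) (A (Q n)) := by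
    intro m n hmn
    exact (hAB (Q m) (hQ m)).mono_right ((hAR _ (hQ n)).trans (hQanti (Nat.succ_le_of_lt hmn)))
  obtain ⟨V, hV, hVc⟩ := hY (fun n => range fun x => f '' (A (Q n) ∩ Metric.ball x (ε / 2)))
    fun n => by
      refine ⟨?_, ?_⟩
      · rintro _ ⟨x, rfl⟩
        exact hopen _ ((hA _ (hQ n)).1.inter Metric.isOpen_ball)
      · refine eq_univ_of_forall fun y => ?_
        obtain ⟨x, hx, hxy⟩ : y ∈ f '' A (Q n) := (hA _ (hQ n)).2 ▸ mem_univ y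
        exact ⟨_, ⟨x, rfl⟩, x, ⟨hx, Metric.mem_ball_self (by positivity)⟩, hxy⟩
  have hVs : ∀ n, ∀ U ∈ V n, ∃ x, U ⊆ f '' (A (Q n) ∩ Metric.ball x (ε / 2)) := by
    intro n U hU
    obtain ⟨_, ⟨s, rfl⟩, hs⟩ := (hV n).2.2 U hU
    exact ⟨s, hs⟩
  classical
  choose! p hp using hVs
  set T : ℕ → Set Y → Set X := fun n U => A (Q n) ∩ Metric.ball (p n U) (ε / 2) ∩ f ⁻¹' U with hT
  set 𝒬 : Set (Set X) := {P | ∃ n, ∃ U ∈ V n, P = T n U} with h𝒬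
  have hPo : ∀ P ∈ 𝒬, IsOpen P := by
    rintro _ ⟨n, U, hU, rfl⟩
    exact ((hA _ (hQ n)).1.inter Metric.isOpen_ball).inter (((hV n).1 U hU).preimage hf)
  refine ⟨⋃₀ 𝒬, ⟨isOpen_sUnion hPo, ?_⟩, ?_, 𝒬, hPo, ?_, subset_rfl, ?_⟩
  · refine eq_univ_of_forall fun y => ?_
    obtain ⟨U, hU, hyU⟩ : y ∈ ⋃₀ (⋃ n, V n) := hVc ▸ mem_univ y
    obtain ⟨n, hn⟩ := mem_iUnion.1 hU
    obtain ⟨x, hx, hxy⟩ := hp n U hn hyU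
    exact ⟨x, ⟨T n U, ⟨n, U, hn, rfl⟩, hx, by rw [mem_preimage, hxy]; exact hyU⟩, hxy⟩
  · refine (closure_mono ?_).trans hR₀R
    rintro x ⟨_, ⟨n, U, hU, rfl⟩, hx⟩
    exact hQanti (Nat.zero_le n) (hAR _ (hQ n) hx.1.1)
  · rintro _ ⟨n, U, hU, rfl⟩ _ ⟨n', U', hU', rfl⟩ hne
    rcases lt_trichotomy n n' with hlt | rfl | hlt
    · exact (hdisj n n' hlt).mono (fun x hx => hx.1.1) (fun x hx => hx.1.1)
    · have hUU : U ≠ U' := by rintro rfl; exact hne rfl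
      exact (((hV n).2.1 hU hU' hUU).preimage f).mono (fun x hx => hx.2) (fun x hx => hx.2)
    · exact (hdisj n' n hlt).symm.mono (fun x hx => hx.1.1) (fun x hx => hx.1.1)
  · rintro _ ⟨n, U, hU, rfl⟩ x hx y hy
    have h1 := Metric.mem_ball.1 hx.1.2
    have h2 := Metric.mem_ball.1 hy.1.2
    have := dist_triangle_right x y (p n U)
    linarith

theorem exists_zero_dim {X Y : Type*} [MetricSpace X] [MetricSpace Y] (hY : IsCSpace Y)
    (f : X → Y) (hf : Continuous f) (hopen : IsOpenMap f)
    (hcpt : ∀ y : Y, IsCompact (f ⁻¹' {y}))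
    (hdense : ∀ y : Y, ∀ x ∈ f ⁻¹' {y}, AccPt x (𝓟 (f ⁻¹' {y})))
    (R : Set X) (hR : IsOpen R ∧ f '' R = univ) :
    ∃ Z : Set X, IsClosed Z ∧ Z ⊆ R ∧ f '' Z = univ ∧ SmallPart Z := by
  choose! A hA hAR hAP using exists_small hY f hf hopen hdense
  have hpos : ∀ n : ℕ, (0 : ℝ) < 1 / ((n : ℝ) + 1) := fun n => Nat.one_div_pos_of_nat
  let Q : ℕ → Set X := fun n => Nat.rec R (fun n k => A (1 / ((n : ℝ) + 1)) k) n
  have hQ : ∀ n, IsOpen (Q n) ∧ f '' Q n = univ := by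
    intro n
    induction n with
    | zero => exact hR
    | succ n ih => exact hA _ (Q n) (hpos n) ih
  have hQc : ∀ n, closure (Q (n + 1)) ⊆ Q n := fun n => hAR _ (Q n) (hpos n) (hQ n)
  have hZQ : ∀ n, (⋂ n, closure (Q (n + 1))) ⊆ Q n := fun n => (iInter_subset _ n).trans (hQc n)
  refine ⟨⋂ n, closure (Q (n + 1)), isClosed_iInter fun _ => isClosed_closure, hZQ 0, ?_, ?_⟩
  · refine eq_univ_of_forall fun y => ?_
    have hne : (⋂ n, closure (Q (n + 1)) ∩ f ⁻¹' {y}).Nonempty := by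
      apply IsCompact.nonempty_iInter_of_sequence_nonempty_isCompact_isClosed
      · intro n
        exact inter_subset_inter_left _ ((hQc (n + 1)).trans subset_closure)
      · intro n
        obtain ⟨x, hx, hxy⟩ : y ∈ f '' Q (n + 1) := (hQ (n + 1)).2 ▸ mem_univ y
        exact ⟨x, subset_closure hx, hxy⟩
      · exact (hcpt y).inter_left isClosed_closure
      · intro n
        exact isClosed_closure.inter (hcpt y).isClosed
    obtain ⟨x, hx⟩ := hne
    rw [mem_iInter] at hx
    exact ⟨x, mem_iInter.2 fun n => (hx n).1, (hx 0).2⟩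
  · intro ε hε
    obtain ⟨n, hn⟩ := exists_nat_one_div_lt hε
    obtain ⟨𝒬, h1, h2, h3, h4⟩ := hAP _ (Q n) (hpos n) (hQ n)
    exact ⟨𝒬, h1, h2, (hZQ (n + 1)).trans h3, fun P hP x hx y hy => (h4 P hP x hx y hy).trans hn⟩

theorem statement16 {X Y : Type*} [TopologicalSpace X] [TopologicalSpace.MetrizableSpace X]
    [TopologicalSpace Y] [TopologicalSpace.MetrizableSpace Y] (hY : IsCSpace Y)
    (f : X → Y) (hf : Continuous f) (hopen : IsOpenMap f) (hclosed : IsClosedMap f)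
    (hcpt : ∀ y : Y, IsCompact (f ⁻¹' {y})) (hsurj : Function.Surjective f)
    (hdense : ∀ y : Y, ∀ x ∈ f ⁻¹' {y}, AccPt x (𝓟 (f ⁻¹' {y}))) :
    Dense {H : ↥{S : Hyper X | f '' S.carrier = Set.univ} |
      CovDimZero ↥(H : Hyper X).carrier} := by
  letI := TopologicalSpace.metrizableSpaceMetric X
  letI := TopologicalSpace.metrizableSpaceMetric Y
  rw [dense_iff_inter_open]
  rintro O hO ⟨H₀, hH₀⟩
  obtain ⟨O', hO', rfl⟩ := isOpen_induced_iff.1 hO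
  obtain ⟨U, hU, hHU, P, hP, hPH, hS⟩ := hyper_nbhd hO' H₀.1 hH₀
  have hH₀f : f '' H₀.1.carrier = univ := H₀.2
  have hUf : f '' U = univ := univ_subset_iff.1 (hH₀f ▸ image_mono hHU)
  obtain ⟨Z, hZ, hZU, hZf, hZs⟩ := exists_zero_dim hY f hf hopen hcpt hdense U ⟨hU, hUf⟩
  obtain ⟨hs, hc⟩ := hZs.union_finite hZ hP
  have hZne : (P ∪ Z).Nonempty := by
    obtain ⟨x, _⟩ := H₀.1.nonempty'
    obtain ⟨z, hz, _⟩ : f x ∈ f '' Z := hZf ▸ mem_univ _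
    exact ⟨z, Or.inr hz⟩
  refine ⟨⟨⟨P ∪ Z, hc, hZne⟩, ?_⟩, ?_, ?_⟩
  · exact univ_subset_iff.1 (hZf ▸ image_mono subset_union_right)
  · exact hS _ subset_union_left (union_subset (hPH.trans hHU) hZU)
  · exact hs.covDimZero
end

section
/- Let X be a compact metrizable space, and let 𝒻₀(X) be the set of all nonempty closed zero-dimensional subsets of X. Then 𝒻₀(X) is a G_δ-subset of the hyperspace 𝒻(X) of all nonempty closed subsets of X with the Vietoris topology. -/
open Set Topology Filter

/-- Sets covered by a finite disjoint open family of mesh less than `ε`. -/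
def SmallCovered {X : Type*} [MetricSpace X] (ε : ℝ) : Set (Hyper X) :=
  {S | ∃ 𝒱 : Set (Set X), 𝒱.Finite ∧ (∀ V ∈ 𝒱, IsOpen V) ∧ 𝒱.Pairwise Disjoint ∧
    (∀ V ∈ 𝒱, ∀ x ∈ V, ∀ y ∈ V, dist x y < ε) ∧ S.carrier ⊆ ⋃₀ 𝒱}

theorem isOpen_subset_hyper {X : Type*} [TopologicalSpace X] (U : Set X) (hU : IsOpen U) :
    IsOpen {S : Hyper X | S.carrier ⊆ U} := by
  apply TopologicalSpace.isOpen_generateFrom_of_mem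
  refine ⟨{U}, by simpa using hU, ?_⟩
  ext S
  simp only [mem_setOf_eq, Finset.coe_singleton, sUnion_singleton, Finset.mem_singleton,
    forall_eq]
  refine ⟨fun h => ⟨h, ?_⟩, fun h => h.1⟩
  rw [inter_eq_self_of_subset_left h]
  exact S.nonempty'

theorem isOpen_smallCovered {X : Type*} [MetricSpace X] (ε : ℝ) :
    IsOpen (SmallCovered ε : Set (Hyper X)) := by
  rw [isOpen_iff_forall_mem_open]
  rintro S ⟨𝒱, hf, ho, hd, hs, hc⟩
  exact ⟨{T | T.carrier ⊆ ⋃₀ 𝒱}, fun T hT => ⟨𝒱, hf, ho, hd, hs, hT⟩,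
    isOpen_subset_hyper _ (isOpen_sUnion ho), hc⟩

theorem covDimZero_of_small {X : Type*} [MetricSpace X] [CompactSpace X] (S : Hyper X)
    (h : ∀ n : ℕ, S ∈ SmallCovered (1 / ((n : ℝ) + 1))) : CovDimZero ↥S.carrier := by
  classical
  intro 𝒰 hU hcov
  have : CompactSpace S.carrier := isCompact_iff_compactSpace.1 S.isClosed'.isCompact
  obtain ⟨δ, hδ, hL⟩ := lebesgue_number_lemma_of_metric_sUnion
    (isCompact_univ (X := S.carrier)) (c := (𝒰 : Set (Set S.carrier)))
    (by simpa using hU) hcov.ge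
  obtain ⟨n, hn⟩ := exists_nat_one_div_lt hδ
  obtain ⟨𝒱, hf, ho, hd, hs, hc⟩ := h n
  refine ⟨(hf.toFinset.image (fun V => (Subtype.val ⁻¹' V : Set S.carrier))).filter
    Set.Nonempty, ?_, ?_, ?_, ?_⟩
  · intro V hV
    simp only [Finset.mem_filter, Finset.mem_image, Finite.mem_toFinset] at hV
    obtain ⟨⟨W, hW, rfl⟩, -⟩ := hV
    exact (ho W hW).preimage continuous_subtype_val
  · intro V hV V' hV' hne
    simp only [mem_setOf_eq, Finset.mem_filter, Finset.mem_image, Finite.mem_toFinset] at hV hV'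
    obtain ⟨⟨W, hW, rfl⟩, -⟩ := hV
    obtain ⟨⟨W', hW', rfl⟩, -⟩ := hV'
    exact (hd hW hW' (fun e => hne (by rw [e]))).preimage _
  · intro V hV
    simp only [Finset.mem_filter, Finset.mem_image, Finite.mem_toFinset] at hV
    obtain ⟨⟨W, hW, rfl⟩, x, hx⟩ := hV
    obtain ⟨U, hU', hxU⟩ := hL x (mem_univ _)
    exact ⟨U, hU', fun y hy => hxU ((hs W hW y hy x hx).trans hn)⟩
  · rw [eq_univ_iff_forall]
    intro x
    obtain ⟨W, hW, hx⟩ := hc x.2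
    refine ⟨Subtype.val ⁻¹' W, ?_, hx⟩
    simp only [Finset.coe_filter, mem_setOf_eq, Finset.mem_image, Finite.mem_toFinset]
    exact ⟨⟨W, hW, rfl⟩, x, hx⟩

theorem small_of_covDimZero {X : Type*} [MetricSpace X] [CompactSpace X] (S : Hyper X)
    (h : CovDimZero ↥S.carrier) (ε : ℝ) (hε : 0 < ε) : S ∈ SmallCovered ε := by
  classical
  have : Nonempty X := ⟨S.nonempty'.some⟩
  obtain ⟨t, -, htf, ht⟩ := finite_cover_balls_of_compact (isCompact_univ (X := X)) (half_pos hε)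
  obtain ⟨𝒱, ho, hd, hr, hc⟩ := h
    (htf.toFinset.image (fun c => (Subtype.val ⁻¹' Metric.ball c (ε / 2) : Set S.carrier)))
    (by
      intro U hU
      simp only [Finset.mem_image] at hU
      obtain ⟨c, -, rfl⟩ := hU
      exact Metric.isOpen_ball.preimage continuous_subtype_val)
    (by
      rw [eq_univ_iff_forall]
      intro x
      have hx := ht (mem_univ (x : X))
      simp only [mem_iUnion] at hx
      obtain ⟨c, hct, hx⟩ := hx
      refine ⟨Subtype.val ⁻¹' Metric.ball c (ε / 2), ?_, hx⟩
      rw [Finset.mem_coe, Finset.mem_image]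
      exact ⟨c, by simpa using hct, rfl⟩)
  have hr' : ∀ V ∈ 𝒱, ∃ c : X, V ⊆ Subtype.val ⁻¹' Metric.ball c (ε / 2) := by
    intro V hV
    obtain ⟨U, hU, hVU⟩ := hr V hV
    simp only [Finset.mem_image] at hU
    obtain ⟨c, -, rfl⟩ := hU
    exact ⟨c, hVU⟩
  choose! c hcb using hr'
  let O : Set S.carrier → Set X := fun V =>
    {x | Metric.infEDist x (Subtype.val '' V) < Metric.infEDist x (Subtype.val '' Vᶜ)} ∩
      Metric.ball (c V) (ε / 2)
  refine ⟨O '' (𝒱 : Set (Set S.carrier)), 𝒱.finite_toSet.image _, ?_, ?_, ?_, ?_⟩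
  · rintro _ ⟨V, hV, rfl⟩
    exact (isOpen_lt Metric.continuous_infEDist Metric.continuous_infEDist).inter
      Metric.isOpen_ball
  · rintro _ ⟨V, hV, rfl⟩ _ ⟨W, hW, rfl⟩ hne
    have hVW : Disjoint V W := hd hV hW (fun e => hne (by rw [e]))
    rw [Set.disjoint_left]
    rintro x ⟨hx, -⟩ ⟨hx', -⟩
    have h1 : Metric.infEDist x (Subtype.val '' Vᶜ) ≤ Metric.infEDist x (Subtype.val '' W) :=
      Metric.infEDist_anti (image_mono hVW.subset_compl_left)
    have h2 : Metric.infEDist x (Subtype.val '' Wᶜ) ≤ Metric.infEDist x (Subtype.val '' V) :=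
      Metric.infEDist_anti (image_mono hVW.subset_compl_right)
    exact lt_irrefl _ (((hx.trans_le h1).trans hx').trans_le h2)
  · rintro _ ⟨V, hV, rfl⟩ x ⟨-, hx⟩ y ⟨-, hy⟩
    rw [Metric.mem_ball] at hx hy
    have := dist_triangle_right x y (c V)
    linarith
  · intro x hx
    have hx' : (⟨x, hx⟩ : S.carrier) ∈ ⋃₀ (𝒱 : Set (Set S.carrier)) := by rw [hc]; trivial
    obtain ⟨V, hV, hxV⟩ := hx'
    refine ⟨O V, ⟨V, hV, rfl⟩, ?_, hcb V hV hxV⟩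
    have h0 : Metric.infEDist x (Subtype.val '' V) = 0 :=
      Metric.infEDist_zero_of_mem ⟨_, hxV, rfl⟩
    rw [mem_setOf_eq, h0, pos_iff_ne_zero]
    intro h1
    rw [← Metric.mem_closure_iff_infEDist_zero] at h1
    have h2 : (⟨x, hx⟩ : S.carrier) ∈ closure Vᶜ := closure_subtype.2 h1
    rw [(ho V hV).isClosed_compl.closure_eq] at h2
    exact h2 hxV

theorem statement17 {X : Type*} [TopologicalSpace X] [CompactSpace X]
    [TopologicalSpace.MetrizableSpace X] :
    IsGδ {S : Hyper X | CovDimZero ↥S.carrier} := by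
  letI : MetricSpace X := TopologicalSpace.metrizableSpaceMetric X
  have : {S : Hyper X | CovDimZero ↥S.carrier} =
      ⋂ n : ℕ, SmallCovered (1 / ((n : ℝ) + 1)) := by
    ext S
    rw [mem_iInter]
    exact ⟨fun h n => small_of_covDimZero S h _ (by positivity), covDimZero_of_small S⟩
  rw [this]
  exact IsGδ.iInter_of_isOpen fun n => isOpen_smallCovered _
end

section
/- Let X be a compact metrizable space, Y a metrizable C-space, and f : X → Y an open continuous surjection such that each fiber f⁻¹(y) is dense in itself (has no isolated points). Let 𝒻(f) = {H : H is a nonempty closed subset of X with f(H) = Y}, considered as a subspace of the hyperspace of nonempty closed subsets of X with the Vietoris topology. Then the set 𝒻₀(f) = {H ∈ 𝒻(f) : H is zero-dimensional} is a dense G_δ-subset of 𝒻(f) with respect to the Vietoris topology. -/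
open Set Topology Filter

/-! ### Vietoris topology basics -/

theorem Hyper.isOpen_subset {X : Type*} [TopologicalSpace X] {U : Set X} (hU : IsOpen U) :
    IsOpen {S : Hyper X | S.carrier ⊆ U} := by
  classical
  refine TopologicalSpace.isOpen_generateFrom_of_mem ⟨{U}, by simpa using hU, ?_⟩
  ext S
  simp only [mem_ofPred_eq, Finset.coe_singleton, sUnion_singleton, Finset.mem_singleton,
    forall_eq]
  refine ⟨fun h => ⟨h, ?_⟩, fun h => h.1⟩
  obtain ⟨x, hx⟩ := S.nonempty'
  exact ⟨x, hx, h hx⟩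

theorem Hyper.isOpen_inter {X : Type*} [TopologicalSpace X] {U : Set X} (hU : IsOpen U) :
    IsOpen {S : Hyper X | (S.carrier ∩ U).Nonempty} := by
  classical
  refine TopologicalSpace.isOpen_generateFrom_of_mem ⟨{univ, U}, by simpa using hU, ?_⟩
  ext S
  simp [S.nonempty']

theorem Hyper.ext_carrier {X : Type*} [TopologicalSpace X] {S T : Hyper X}
    (h : S.carrier = T.carrier) : S = T := by
  cases S; cases T; simp_all

theorem Hyper.compactSpace (X : Type*) [TopologicalSpace X] [CompactSpace X] [T2Space X] :
    CompactSpace (Hyper X) := by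
  let g : TopologicalSpace.NonemptyCompacts X → Hyper X := fun K =>
    ⟨K, K.isCompact.isClosed, K.nonempty⟩
  have hg : Continuous g := by
    refine continuous_generateFrom_iff.2 ?_
    rintro _ ⟨𝒱, h𝒱, rfl⟩
    have : g ⁻¹' {S : Hyper X | S.carrier ⊆ ⋃₀ (𝒱 : Set (Set X)) ∧
        ∀ V ∈ 𝒱, (S.carrier ∩ V).Nonempty} =
      {K : TopologicalSpace.NonemptyCompacts X | (K : Set X) ⊆ ⋃₀ (𝒱 : Set (Set X))} ∩
        ⋂ V ∈ 𝒱, {K : TopologicalSpace.NonemptyCompacts X | ((K : Set X) ∩ V).Nonempty} := by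
      ext K
      simp [g]
    rw [this]
    refine (TopologicalSpace.NonemptyCompacts.isOpen_subsets_of_isOpen
      (isOpen_sUnion h𝒱)).inter (isOpen_biInter_finset fun V hV => ?_)
    exact TopologicalSpace.NonemptyCompacts.isOpen_inter_nonempty_of_isOpen (h𝒱 V hV)
  have hs : Function.Surjective g := fun S =>
    ⟨⟨⟨S.carrier, S.isClosed'.isCompact⟩, S.nonempty'⟩, rfl⟩
  exact hs.compactSpace hg

theorem Hyper.t2Space (X : Type*) [TopologicalSpace X] [CompactSpace X] [T2Space X] :
    T2Space (Hyper X) := by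
  let g : Hyper X → TopologicalSpace.NonemptyCompacts X := fun S =>
    ⟨⟨S.carrier, S.isClosed'.isCompact⟩, S.nonempty'⟩
  have hg : Continuous g := by
    refine continuous_induced_rng.2 (continuous_generateFrom_iff.2 ?_)
    rintro _ (⟨U, hU, rfl⟩ | ⟨U, hU, rfl⟩)
    · exact Hyper.isOpen_subset hU
    · exact Hyper.isOpen_inter hU
  refine T2Space.of_injective_continuous (f := g) ?_ hg
  intro S T h
  exact Hyper.ext_carrier (congrArg (fun K : TopologicalSpace.NonemptyCompacts X => (K : Set X)) h)

theorem Hyper.exists_delta {X : Type*} [MetricSpace X] [CompactSpace X] {T : Set (Hyper X)}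
    (hT : IsOpen T) : ∀ H ∈ T, ∃ δ > 0, ∀ H' : Hyper X,
      H'.carrier ⊆ Metric.thickening δ H.carrier → H.carrier ⊆ Metric.thickening δ H'.carrier →
      H' ∈ T := by
  classical
  induction hT with
  | basic s hs =>
    obtain ⟨𝒱, h𝒱, rfl⟩ := hs
    rintro H ⟨h1, h2⟩
    obtain ⟨δ, hδ, hsub⟩ := H.isClosed'.isCompact.exists_thickening_subset_open
      (isOpen_sUnion (s := (𝒱 : Set (Set X))) h𝒱) h1
    have key : ∀ 𝒲 : Finset (Set X), 𝒲 ⊆ 𝒱 → ∃ η > 0, ∀ H' : Hyper X,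
        H.carrier ⊆ Metric.thickening η H'.carrier → ∀ V ∈ 𝒲, (H'.carrier ∩ V).Nonempty := by
      intro 𝒲
      induction 𝒲 using Finset.induction_on with
      | empty => intro _; exact ⟨1, one_pos, by simp⟩
      | insert V 𝒲 hV ih =>
        intro hsub
        obtain ⟨η, hη, h⟩ := ih (fun W hW => hsub (Finset.mem_insert_of_mem hW))
        obtain ⟨x, hxH, hxV⟩ := h2 V (hsub (Finset.mem_insert_self _ _))
        obtain ⟨r, hr, hball⟩ := Metric.isOpen_iff.1 (h𝒱 V (hsub (Finset.mem_insert_self _ _))) x hxV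
        refine ⟨min η r, lt_min hη hr, fun H' hH' W hW => ?_⟩
        rcases Finset.mem_insert.1 hW with rfl | hW
        · obtain ⟨z, hz, hd⟩ := Metric.mem_thickening_iff.1 (hH' hxH)
          exact ⟨z, hz, hball (by rw [Metric.mem_ball, dist_comm]; exact hd.trans_le (min_le_right _ _))⟩
        · exact h H' (hH'.trans (Metric.thickening_mono (min_le_left _ _) _)) W hW
    obtain ⟨η, hη, h⟩ := key 𝒱 (Finset.Subset.refl _)
    refine ⟨min δ η, lt_min hδ hη, fun H' a b => ⟨?_, ?_⟩⟩
    · exact (a.trans (Metric.thickening_mono (min_le_left _ _) _)).trans hsub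
    · exact h H' (b.trans (Metric.thickening_mono (min_le_right _ _) _))
  | univ => intro H _; exact ⟨1, one_pos, fun _ _ _ => mem_univ _⟩
  | inter s t _ _ ihs iht =>
    rintro H ⟨hs, ht⟩
    obtain ⟨a, ha, h1⟩ := ihs H hs
    obtain ⟨b, hb, h2⟩ := iht H ht
    refine ⟨min a b, lt_min ha hb, fun H' p q => ⟨h1 H' ?_ ?_, h2 H' ?_ ?_⟩⟩
    · exact p.trans (Metric.thickening_mono (min_le_left _ _) _)
    · exact q.trans (Metric.thickening_mono (min_le_left _ _) _)
    · exact p.trans (Metric.thickening_mono (min_le_right _ _) _)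
    · exact q.trans (Metric.thickening_mono (min_le_right _ _) _)
  | sUnion 𝒮 _ ih =>
    rintro H ⟨s, hs, hH⟩
    obtain ⟨a, ha, h⟩ := ih s hs H hH
    exact ⟨a, ha, fun H' p q => ⟨s, hs, h H' p q⟩⟩

/-! ### Zero-dimensionality via small disjoint families -/

/-- `H` is covered by a finite disjoint family of open sets of diameter less than `ε`. -/
def SmallOpen {X : Type*} [MetricSpace X] (ε : ℝ) (H : Set X) : Prop :=
  ∃ 𝒱 : Set (Set X), 𝒱.Finite ∧ (∀ V ∈ 𝒱, IsOpen V) ∧ 𝒱.Pairwise Disjoint ∧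
    (∀ V ∈ 𝒱, ∀ x ∈ V, ∀ y ∈ V, dist x y < ε) ∧ H ⊆ ⋃₀ 𝒱

theorem smallOpen_of_closed {X : Type*} [MetricSpace X] [CompactSpace X] {ε : ℝ} (hε : 0 < ε)
    {H : Set X} (ℬ : Set (Set X)) (hfin : ℬ.Finite) (hcl : ∀ P ∈ ℬ, IsClosed P)
    (hdisj : ℬ.Pairwise Disjoint) (hsm : ∀ P ∈ ℬ, ∀ x ∈ P, ∀ y ∈ P, dist x y < ε / 2)
    (hcov : H ⊆ ⋃₀ ℬ) : SmallOpen ε H := by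
  have key : ∀ P ∈ ℬ, ∀ Q ∈ ℬ, ∃ δ > 0, P ≠ Q →
      Disjoint (Metric.thickening δ P) (Metric.thickening δ Q) := by
    intro P hP Q hQ
    by_cases h : P = Q
    · exact ⟨1, one_pos, fun h' => absurd h h'⟩
    · obtain ⟨δ, hδ, hd⟩ := (hdisj hP hQ h).exists_thickenings (hcl P hP).isCompact (hcl Q hQ)
      exact ⟨δ, hδ, fun _ => hd⟩
  choose! d hdpos hd using key
  obtain ⟨δ, hδ, hδle⟩ : ∃ δ > 0, ∀ P ∈ ℬ, ∀ Q ∈ ℬ, δ ≤ d P Q := by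
    have hf : ((fun p : Set X × Set X => d p.1 p.2) '' (ℬ ×ˢ ℬ)).Finite := (hfin.prod hfin).image _
    rcases (ℬ ×ˢ ℬ).eq_empty_or_nonempty with he | hne
    · refine ⟨1, one_pos, fun P hP Q hQ => ?_⟩
      exact absurd (he ▸ (show (P, Q) ∈ ℬ ×ˢ ℬ from ⟨hP, hQ⟩)) (notMem_empty _)
    · obtain ⟨p, hp, hmin⟩ := (hfin.prod hfin).exists_minimalFor
        (fun p : Set X × Set X => d p.1 p.2) _ hne
      refine ⟨d p.1 p.2, hdpos _ hp.1 _ hp.2, fun P hP Q hQ => ?_⟩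
      rcases le_total (d p.1 p.2) (d P Q) with h | h
      · exact h
      · exact hmin (j := (P, Q)) ⟨hP, hQ⟩ h
  set r := min δ (ε / 4) with hr
  have hr0 : 0 < r := lt_min hδ (by linarith)
  refine ⟨Metric.thickening r '' ℬ, hfin.image _, ?_, ?_, ?_, ?_⟩
  · rintro _ ⟨P, -, rfl⟩; exact Metric.isOpen_thickening
  · rintro _ ⟨P, hP, rfl⟩ _ ⟨Q, hQ, rfl⟩ hne
    have hPQ : P ≠ Q := fun h => hne (by rw [h])
    have hle : r ≤ d P Q := (min_le_left _ _).trans (hδle P hP Q hQ)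
    exact (hd P hP Q hQ hPQ).mono (Metric.thickening_mono hle _) (Metric.thickening_mono hle _)
  · rintro _ ⟨P, hP, rfl⟩ x hx y hy
    obtain ⟨a, ha, hxa⟩ := Metric.mem_thickening_iff.1 hx
    obtain ⟨b, hb, hyb⟩ := Metric.mem_thickening_iff.1 hy
    have h1 := hsm P hP a ha b hb
    have h2 := dist_triangle4 x a b y
    rw [dist_comm b y] at h2
    have h3 : r ≤ ε / 4 := min_le_right _ _
    linarith
  · intro x hx
    obtain ⟨P, hP, hxP⟩ := hcov hx
    exact ⟨_, ⟨P, hP, rfl⟩, Metric.self_subset_thickening hr0 P hxP⟩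

theorem isOpen_smallOpen {X : Type*} [MetricSpace X] (ε : ℝ) :
    IsOpen {H : Hyper X | SmallOpen ε H.carrier} := by
  have : {H : Hyper X | SmallOpen ε H.carrier} =
      ⋃ (𝒱 : Set (Set X)) (_ : 𝒱.Finite ∧ (∀ V ∈ 𝒱, IsOpen V) ∧ 𝒱.Pairwise Disjoint ∧
        (∀ V ∈ 𝒱, ∀ x ∈ V, ∀ y ∈ V, dist x y < ε)), {H : Hyper X | H.carrier ⊆ ⋃₀ 𝒱} := by
    ext H
    simp only [SmallOpen, mem_ofPred_eq, mem_iUnion, exists_prop, and_assoc]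
  rw [this]
  exact isOpen_iUnion fun 𝒱 => isOpen_iUnion fun h => Hyper.isOpen_subset (isOpen_sUnion h.2.1)

theorem smallOpen_of_covDimZero {X : Type*} [MetricSpace X] [CompactSpace X] {H : Set X}
    (hH : IsClosed H) (h0 : CovDimZero H) {ε : ℝ} (hε : 0 < ε) : SmallOpen ε H := by
  classical
  obtain ⟨t, -, htfin, ht⟩ := (isCompact_univ (X := X)).finite_cover_balls
    (e := ε / 5) (by linarith)
  obtain ⟨𝒱, hVo, hVd, hVr, hVc⟩ := h0
    (htfin.toFinset.image (fun x => (Subtype.val : H → X) ⁻¹' Metric.ball x (ε / 5))) (by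
      intro U hU
      obtain ⟨x, -, rfl⟩ := Finset.mem_image.1 hU
      exact Metric.isOpen_ball.preimage continuous_subtype_val) (by
      refine eq_univ_of_forall fun z => ?_
      obtain ⟨x, hx, hz⟩ := mem_iUnion₂.1 (ht (mem_univ (z : X)))
      exact ⟨_, Finset.mem_coe.2 (Finset.mem_image_of_mem _ (htfin.mem_toFinset.2 hx)), hz⟩)
  have hcompl : ∀ V ∈ 𝒱, IsClosed V := by
    intro V hV
    have : V = (⋃₀ {W : Set H | W ∈ 𝒱 ∧ W ≠ V})ᶜ := by
      ext z
      constructor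
      · rintro hz ⟨W, ⟨hW, hne⟩, hzW⟩
        exact Set.disjoint_left.1 (hVd hW hV hne) hzW hz
      · intro hz
        obtain ⟨W, hW, hzW⟩ : z ∈ ⋃₀ (𝒱 : Set (Set H)) := hVc ▸ mem_univ z
        by_cases h : W = V
        · exact h ▸ hzW
        · exact absurd ⟨W, ⟨hW, h⟩, hzW⟩ hz
    rw [this]
    exact (isOpen_sUnion fun W hW => hVo W hW.1).isClosed_compl
  refine smallOpen_of_closed hε ((fun V : Set H => Subtype.val '' V) '' (𝒱 : Set (Set H)))
    (𝒱.finite_toSet.image _) ?_ ?_ ?_ ?_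
  · rintro _ ⟨V, hV, rfl⟩
    exact hH.isClosedEmbedding_subtypeVal.isClosedMap _ (hcompl V hV)
  · rintro _ ⟨V, hV, rfl⟩ _ ⟨W, hW, rfl⟩ hne
    have : V ≠ W := fun h => hne (by rw [h])
    exact (Set.disjoint_image_iff Subtype.val_injective).2 (hVd hV hW this)
  · rintro _ ⟨V, hV, rfl⟩ _ ⟨x, hx, rfl⟩ _ ⟨y, hy, rfl⟩
    obtain ⟨U, hU, hVU⟩ := hVr V hV
    obtain ⟨c, -, rfl⟩ := Finset.mem_image.1 hU
    have h1 : dist (x : X) c < ε / 5 := hVU hx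
    have h2 : dist (y : X) c < ε / 5 := hVU hy
    have := dist_triangle_right (x : X) y c
    linarith
  · intro x hx
    obtain ⟨W, hW, hzW⟩ : (⟨x, hx⟩ : H) ∈ ⋃₀ (𝒱 : Set (Set H)) := hVc ▸ mem_univ _
    exact ⟨_, ⟨W, hW, rfl⟩, ⟨_, hzW, rfl⟩⟩

theorem covDimZero_of_smallOpen {X : Type*} [MetricSpace X] [CompactSpace X] {H : Set X}
    (hH : IsClosed H) (h : ∀ n : ℕ, SmallOpen (1 / ((n : ℝ) + 1)) H) : CovDimZero H := by
  classical
  intro 𝒰 hUo hUc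
  have hc : CompactSpace H := isCompact_iff_compactSpace.1 hH.isCompact
  obtain ⟨δ, hδ, hleb⟩ := lebesgue_number_lemma_of_metric_sUnion (isCompact_univ (X := H))
    (c := (𝒰 : Set (Set H))) hUo hUc.ge
  obtain ⟨n, hn⟩ := exists_nat_one_div_lt hδ
  obtain ⟨𝒱, hfin, hVo, hVd, hVs, hVc⟩ := h n
  have hfin' : ({V ∈ (fun V : Set X => (Subtype.val : H → X) ⁻¹' V) '' 𝒱 | V.Nonempty}).Finite :=
    (hfin.image _).subset (fun V hV => hV.1)
  refine ⟨hfin'.toFinset, ?_, ?_, ?_, ?_⟩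
  · intro V hV
    obtain ⟨⟨W, hW, rfl⟩, -⟩ := hfin'.mem_toFinset.1 hV
    exact (hVo W hW).preimage continuous_subtype_val
  · intro V hV V' hV' hne
    obtain ⟨⟨W, hW, rfl⟩, -⟩ := hfin'.mem_toFinset.1 hV
    obtain ⟨⟨W', hW', rfl⟩, -⟩ := hfin'.mem_toFinset.1 hV'
    have : W ≠ W' := fun h => hne (by rw [h])
    exact (hVd hW hW' this).preimage _
  · intro V hV
    obtain ⟨⟨W, hW, rfl⟩, z, hz⟩ := hfin'.mem_toFinset.1 hV
    obtain ⟨U, hU, hb⟩ := hleb z (mem_univ _)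
    refine ⟨U, hU, fun y hy => hb ?_⟩
    exact lt_trans (hVs W hW y hy z hz) hn
  · refine eq_univ_of_forall fun z => ?_
    obtain ⟨V, hV, hz⟩ := hVc z.2
    exact ⟨_, Finset.mem_coe.2 (hfin'.mem_toFinset.2 ⟨⟨V, hV, rfl⟩, ⟨z, hz⟩⟩), hz⟩

/-! ### Consequences of the C-space property -/

theorem cspace_selection {X Y : Type*} [TopologicalSpace X] [TopologicalSpace Y] [CompactSpace Y]
    [T2Space Y] (hY : IsCSpace Y) (f : X → Y) (hopen : IsOpenMap f)
    (good : ℕ → Set X → Prop) (hgood : ∀ n y, ∃ B, IsOpen B ∧ good n B ∧ y ∈ f '' B) :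
    ∃ (I : Finset (ℕ × Set Y)) (B : ℕ × Set Y → Set X) (K : ℕ × Set Y → Set Y),
      (∀ i ∈ I, IsOpen (B i) ∧ good i.1 (B i) ∧ IsClosed (K i) ∧ K i ⊆ f '' B i) ∧
      (∀ y, ∃ i ∈ I, y ∈ interior (K i)) ∧
      (∀ i ∈ I, ∀ j ∈ I, i ≠ j → i.1 = j.1 → Disjoint (K i) (K j)) := by
  classical
  obtain ⟨V, hV, hVc⟩ := hY (fun n => {U | ∃ B, IsOpen B ∧ good n B ∧ U = f '' B}) (by
    intro n
    refine ⟨?_, eq_univ_of_forall fun y => ?_⟩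
    · rintro _ ⟨B, hB, -, rfl⟩
      exact hopen _ hB
    · obtain ⟨B, hB, hg, hy⟩ := hgood n y
      exact ⟨_, ⟨B, hB, hg, rfl⟩, hy⟩)
  let J : Set (ℕ × Set Y) := {p | p.2 ∈ V p.1}
  obtain ⟨t, ht⟩ := (isCompact_univ (X := Y)).elim_finite_subcover (fun p : J => p.1.2)
    (fun p => (hV p.1.1).1 _ p.2) (by
      intro y _
      have : y ∈ ⋃₀ (⋃ n, V n) := hVc ▸ mem_univ y
      obtain ⟨U, hU, hy⟩ := this
      obtain ⟨n, hn⟩ := mem_iUnion.1 hU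
      exact mem_iUnion.2 ⟨⟨(n, U), hn⟩, hy⟩)
  obtain ⟨v, hvc, hvo, hvs⟩ := exists_iUnion_eq_closure_subset (u := fun i : t => i.1.1.2)
    (fun i => (hV i.1.1.1).1 _ i.1.2) (fun x => toFinite _) (by
      refine eq_univ_of_forall fun y => ?_
      obtain ⟨p, hp, hy⟩ := mem_iUnion₂.1 (ht (mem_univ y))
      exact mem_iUnion.2 ⟨⟨p, hp⟩, hy⟩)
  have hB : ∀ i : ℕ × Set Y, i ∈ J → ∃ B, IsOpen B ∧ good i.1 B ∧ i.2 ⊆ f '' B := by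
    intro i hi
    obtain ⟨W, ⟨B, hB, hg, rfl⟩, hs⟩ := (hV i.1).2.2 i.2 hi
    exact ⟨B, hB, hg, hs⟩
  choose! B hBo hBg hBs using hB
  let K : ℕ × Set Y → Set Y := fun i =>
    if h : ∃ hi : i ∈ J, (⟨i, hi⟩ : J) ∈ t then closure (v ⟨⟨i, h.1⟩, h.2⟩) else ∅
  have hK : ∀ i (hi : i ∈ J) (ht : (⟨i, hi⟩ : J) ∈ t), K i = closure (v ⟨⟨i, hi⟩, ht⟩) := by
    intro i hi ht
    exact dif_pos ⟨hi, ht⟩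
  refine ⟨t.map (Function.Embedding.subtype _), B, K, ?_, ?_, ?_⟩
  · intro i hi
    obtain ⟨⟨j, hj⟩, hjt, rfl⟩ := Finset.mem_map.1 hi
    change IsOpen (B j) ∧ good j.1 (B j) ∧ IsClosed (K j) ∧ K j ⊆ f '' B j
    rw [hK j hj hjt]
    exact ⟨hBo j hj, hBg j hj, isClosed_closure, (hvs _).trans (hBs j hj)⟩
  · intro y
    have : y ∈ iUnion v := hvc ▸ mem_univ y
    obtain ⟨⟨⟨j, hj⟩, hjt⟩, hy⟩ := mem_iUnion.1 this
    refine ⟨j, Finset.mem_map.2 ⟨⟨j, hj⟩, hjt, rfl⟩, ?_⟩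
    rw [hK j hj hjt]
    exact interior_maximal subset_closure (hvo _) hy
  · intro i hi j hj hne heq
    obtain ⟨⟨i, hiJ⟩, hit, rfl⟩ := Finset.mem_map.1 hi
    obtain ⟨⟨j, hjJ⟩, hjt, rfl⟩ := Finset.mem_map.1 hj
    change i ≠ j at hne
    change i.1 = j.1 at heq
    change Disjoint (K i) (K j)
    rw [hK i hiJ hit, hK j hjJ hjt]
    refine Disjoint.mono (hvs _) (hvs _) ?_
    refine (hV i.1).2.1 hiJ (by rw [heq]; exact hjJ) ?_
    exact fun h => hne (Prod.ext heq h)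

theorem fiber_move {X Y : Type*} [MetricSpace X] [CompactSpace X] [TopologicalSpace Y]
    (f : X → Y) (hf : Continuous f) (hopen : IsOpenMap f)
    (hdense : ∀ y : Y, ∀ x ∈ f ⁻¹' {y}, AccPt x (𝓟 (f ⁻¹' {y}))) {ρ : ℝ} (hρ : 0 < ρ) :
    ∃ κ > 0, ∀ x, ∃ x', f x' = f x ∧ dist x x' < ρ ∧ κ < dist x x' := by
  have := (isCompact_univ (X := X)).induction_on
    (p := fun s => ∃ κ > 0, ∀ x ∈ s, ∃ x', f x' = f x ∧ dist x x' < ρ ∧ κ < dist x x')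
    ⟨1, one_pos, by simp⟩
    (fun s t hst ⟨κ, h, h'⟩ => ⟨κ, h, fun x hx => h' x (hst hx)⟩) ?_ ?_
  · obtain ⟨κ, h, h'⟩ := this
    exact ⟨κ, h, fun x => h' x (mem_univ x)⟩
  · rintro s t ⟨a, ha, h1⟩ ⟨b, hb, h2⟩
    refine ⟨min a b, lt_min ha hb, ?_⟩
    rintro x (hx | hx)
    · obtain ⟨x', p, q, r⟩ := h1 x hx
      exact ⟨x', p, q, (min_le_left _ _).trans_lt r⟩
    · obtain ⟨x', p, q, r⟩ := h2 x hx
      exact ⟨x', p, q, (min_le_right _ _).trans_lt r⟩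
  · intro x _
    obtain ⟨z, ⟨hzρ, hzf⟩, hne⟩ := accPt_iff_nhds.1 (hdense (f x) x rfl) _
      (Metric.ball_mem_nhds x (half_pos hρ))
    have hd : 0 < dist z x := dist_pos.2 hne
    have hzf : f z = f x := hzf
    rw [Metric.mem_ball] at hzρ
    set r := dist z x / 4 with hr
    refine ⟨Metric.ball x r ∩ f ⁻¹' (f '' Metric.ball z r), ?_, r, by positivity, ?_⟩
    · rw [nhdsWithin_univ]
      refine inter_mem (Metric.ball_mem_nhds x (by positivity)) ?_
      refine ((hopen _ Metric.isOpen_ball).preimage hf).mem_nhds ?_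
      exact ⟨z, Metric.mem_ball_self (by positivity), hzf⟩
    · rintro a ⟨ha, b, hb, hab⟩
      rw [Metric.mem_ball] at ha hb
      refine ⟨b, hab, ?_, ?_⟩
      · have := dist_triangle4 a x z b
        rw [dist_comm x z, dist_comm z b] at this
        linarith
      · have := dist_triangle4 z b a x
        rw [dist_comm z b, dist_comm b a] at this
        linarith

theorem uniform_ball {X Y : Type*} [MetricSpace X] [CompactSpace X] [TopologicalSpace Y]
    [CompactSpace Y] (f : X → Y) (hopen : IsOpenMap f) {G : Set X} (hG : IsOpen G)
    (hGf : f '' G = univ) : ∃ δ > 0, ∀ y, ∃ x, f x = y ∧ Metric.ball x δ ⊆ G := by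
  have := (isCompact_univ (X := Y)).induction_on
    (p := fun s => ∃ δ > 0, ∀ y ∈ s, ∃ x, f x = y ∧ Metric.ball x δ ⊆ G)
    ⟨1, one_pos, by simp⟩
    (fun s t hst ⟨κ, h, h'⟩ => ⟨κ, h, fun x hx => h' x (hst hx)⟩) ?_ ?_
  · obtain ⟨κ, h, h'⟩ := this
    exact ⟨κ, h, fun x => h' x (mem_univ x)⟩
  · rintro s t ⟨a, ha, h1⟩ ⟨b, hb, h2⟩
    refine ⟨min a b, lt_min ha hb, ?_⟩
    rintro x (hx | hx)
    · obtain ⟨x', p, q⟩ := h1 x hx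
      exact ⟨x', p, (Metric.ball_subset_ball (min_le_left _ _)).trans q⟩
    · obtain ⟨x', p, q⟩ := h2 x hx
      exact ⟨x', p, (Metric.ball_subset_ball (min_le_right _ _)).trans q⟩
  · intro y _
    obtain ⟨x, hx, rfl⟩ : y ∈ f '' G := hGf ▸ mem_univ y
    obtain ⟨r, hr, hb⟩ := Metric.isOpen_iff.1 hG x hx
    refine ⟨f '' Metric.ball x (r / 2), ?_, r / 2, half_pos hr, ?_⟩
    · rw [nhdsWithin_univ]
      exact (hopen _ Metric.isOpen_ball).mem_nhds ⟨x, Metric.mem_ball_self (half_pos hr), rfl⟩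
    · rintro _ ⟨a, ha, rfl⟩
      refine ⟨a, rfl, fun b hb' => hb ?_⟩
      rw [Metric.mem_ball] at *
      have := dist_triangle b a x
      linarith

/-- Greedy avoidance of finitely many sets whose diameters decrease fast enough. -/
theorem avoid {X Y : Type*} [MetricSpace X] (f : X → Y) (ρ κ : ℕ → ℝ) (hρ : ∀ n, 0 < ρ n)
    (hκ : ∀ n, 0 < κ n) (h1 : ∀ n, ρ (n + 1) ≤ κ n / 8) (h2 : ∀ n, ρ (n + 1) ≤ ρ n / 2)
    (hmove : ∀ n x, ∃ x', f x' = f x ∧ dist x x' < ρ n ∧ κ n < dist x x')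
    (E : ℕ → Set X) (hE : ∀ n, ∀ a ∈ E n, ∀ b ∈ E n, dist a b ≤ κ n / 2) (N : ℕ) :
    ∀ n x, ∃ x', f x' = f x ∧ dist x x' < 2 * ρ n ∧ ∀ m, n ≤ m → m < n + N → x' ∉ E m := by
  induction N with
  | zero =>
    intro n x
    refine ⟨x, rfl, by simpa using hρ n, fun m a b => by omega⟩
  | succ N ih =>
    intro n x
    obtain ⟨x1, hx1, hd1, hfar⟩ : ∃ x1, f x1 = f x ∧ dist x x1 < ρ n ∧
        ∀ e ∈ E n, κ n / 4 ≤ dist x1 e := by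
      by_cases h : ∀ e ∈ E n, κ n / 4 ≤ dist x e
      · exact ⟨x, rfl, by simpa using hρ n, h⟩
      · push Not at h
        obtain ⟨e, he, hlt⟩ := h
        obtain ⟨x1, a, b, c⟩ := hmove n x
        refine ⟨x1, a, b, fun e' he' => ?_⟩
        have h3 := hE n e he e' he'
        have h4 := dist_triangle4 x e e' x1
        rw [dist_comm e' x1] at h4
        linarith
    obtain ⟨x', hx', hd', hav⟩ := ih (n + 1) x1
    refine ⟨x', hx'.trans hx1, ?_, fun m hm hm' => ?_⟩
    · have := dist_triangle x x1 x'
      have := h2 n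
      linarith
    · rcases hm.eq_or_lt with rfl | hlt
      · intro hx
        have := hfar x' hx
        have := h1 n
        linarith
      · exact hav m hlt (by omega)

theorem exists_small_ball {X Y : Type*} [MetricSpace X] (f : X → Y) {G : Set X} (hG : IsOpen G)
    (hGf : f '' G = univ) {η : ℝ} (hη : 0 < η) (y : Y) :
    ∃ B, IsOpen B ∧ (closure B ⊆ G ∧ ∀ a ∈ closure B, ∀ b ∈ closure B, dist a b ≤ η) ∧
      y ∈ f '' B := by
  obtain ⟨x, hx, rfl⟩ : y ∈ f '' G := hGf ▸ mem_univ y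
  obtain ⟨r, hr, hb⟩ := Metric.isOpen_iff.1 hG x hx
  have hs : 0 < min (r / 2) (η / 2) := lt_min (half_pos hr) (half_pos hη)
  refine ⟨Metric.ball x (min (r / 2) (η / 2)), Metric.isOpen_ball, ⟨?_, ?_⟩,
    ⟨x, Metric.mem_ball_self hs, rfl⟩⟩
  · intro a ha
    have := Metric.mem_closedBall.1 (Metric.closure_ball_subset_closedBall ha)
    refine hb (Metric.mem_ball.2 ?_)
    have := min_le_left (r / 2) (η / 2)
    linarith
  · intro a ha b hb
    have h1 := Metric.mem_closedBall.1 (Metric.closure_ball_subset_closedBall ha)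
    have h2 := Metric.mem_closedBall.1 (Metric.closure_ball_subset_closedBall hb)
    have := min_le_right (r / 2) (η / 2)
    have := dist_triangle_right a b x
    linarith

theorem split_open {X Y : Type*} [MetricSpace X] [CompactSpace X] [TopologicalSpace Y]
    [CompactSpace Y] [T2Space Y] (hY : IsCSpace Y)
    (f : X → Y) (hf : Continuous f) (hopen : IsOpenMap f)
    (hdense : ∀ y : Y, ∀ x ∈ f ⁻¹' {y}, AccPt x (𝓟 (f ⁻¹' {y})))
    {G : Set X} (hG : IsOpen G) (hGf : f '' G = univ) :
    ∃ G0 G1 : Set X, IsOpen G0 ∧ IsOpen G1 ∧ G0 ⊆ G ∧ G1 ⊆ G ∧ Disjoint G0 G1 ∧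
      f '' G0 = univ ∧ f '' G1 = univ := by
  classical
  obtain ⟨δ, hδ, hball⟩ := uniform_ball f hopen hG hGf
  have hm : ∀ ρ : ℝ, 0 < ρ → ∃ κ > 0, ∀ x, ∃ x', f x' = f x ∧ dist x x' < ρ ∧ κ < dist x x' :=
    fun ρ hρ => fiber_move f hf hopen hdense hρ
  choose! k hk hkm using hm
  let ρ : ℕ → ℝ := fun n => Nat.rec (δ / 4) (fun _ r => min (k r / 8) (r / 2)) n
  have hρs : ∀ n, ρ (n + 1) = min (k (ρ n) / 8) (ρ n / 2) := fun n => rfl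
  have hρ : ∀ n, 0 < ρ n := by
    intro n
    induction n with
    | zero => change 0 < δ / 4; positivity
    | succ n ih =>
      rw [hρs]
      have := hk _ ih
      exact lt_min (by linarith) (by linarith)
  have hκ : ∀ n, 0 < k (ρ n) := fun n => hk _ (hρ n)
  obtain ⟨I, B, K, hI, hcov, hdis⟩ := cspace_selection hY f hopen
    (fun n B => closure B ⊆ G ∧ ∀ a ∈ closure B, ∀ b ∈ closure B, dist a b ≤ k (ρ n) / 2)
    (fun n y => exists_small_ball f hG hGf (half_pos (hκ n)) y)
  set C : Set X := ⋃ i ∈ I, closure (B i) ∩ f ⁻¹' K i with hC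
  have hCcl : IsClosed C := I.finite_toSet.isClosed_biUnion fun i hi =>
    isClosed_closure.inter ((hI i hi).2.2.1.preimage hf)
  refine ⟨⋃ i ∈ I, B i ∩ f ⁻¹' interior (K i), G \ C, ?_, hG.sdiff hCcl, ?_, sdiff_subset, ?_, ?_, ?_⟩
  · exact isOpen_biUnion fun i hi => (hI i hi).1.inter (isOpen_interior.preimage hf)
  · exact iUnion₂_subset fun i hi => inter_subset_left.trans
      (subset_closure.trans (hI i hi).2.1.1)
  · refine Set.disjoint_left.2 fun x hx hx' => hx'.2 ?_
    obtain ⟨i, hi, hxi⟩ := mem_iUnion₂.1 hx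
    exact mem_iUnion₂.2 ⟨i, hi, subset_closure hxi.1, interior_subset (s := K i) hxi.2⟩
  · refine eq_univ_of_forall fun y => ?_
    obtain ⟨i, hi, hy⟩ := hcov y
    obtain ⟨x, hx, rfl⟩ := (hI i hi).2.2.2 (interior_subset hy)
    exact ⟨x, mem_iUnion₂.2 ⟨i, hi, hx, hy⟩, rfl⟩
  · refine eq_univ_of_forall fun y => ?_
    obtain ⟨x, hxy, hx⟩ := hball y
    let E : ℕ → Set X := fun n => {a | ∃ i ∈ I, i.1 = n ∧ y ∈ K i ∧ a ∈ closure (B i)}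
    have hE : ∀ n, ∀ a ∈ E n, ∀ b ∈ E n, dist a b ≤ k (ρ n) / 2 := by
      rintro n a ⟨i, hi, hin, hyi, hai⟩ b ⟨j, hj, hjn, hyj, hbj⟩
      have hij : i = j := by
        by_contra hne
        exact Set.disjoint_left.1 (hdis i hi j hj hne (hin.trans hjn.symm)) hyi hyj
      subst hij
      rw [← hin]
      exact (hI i hi).2.1.2 a hai b hbj
    obtain ⟨x', hx', hd, hav⟩ := avoid f ρ (fun n => k (ρ n)) hρ hκ
      (fun n => min_le_left _ _) (fun n => min_le_right _ _) (fun n => hkm _ (hρ n)) E hE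
      (I.sup Prod.fst + 1) 0 x
    refine ⟨x', ⟨hx ?_, ?_⟩, hx'.trans hxy⟩
    · have : ρ 0 = δ / 4 := rfl
      rw [Metric.mem_ball, dist_comm]
      linarith
    · intro hxC
      obtain ⟨i, hi, hxi⟩ := mem_iUnion₂.1 hxC
      have hle : i.1 ≤ I.sup Prod.fst := Finset.le_sup (f := Prod.fst) hi
      refine hav i.1 (Nat.zero_le _) (by omega) ⟨i, hi, rfl, ?_, hxi.1⟩
      have := hxi.2
      rwa [mem_preimage, hx', hxy] at this

theorem disjoint_seq {X Y : Type*} [MetricSpace X] [CompactSpace X] [TopologicalSpace Y]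
    [CompactSpace Y] [T2Space Y] (hY : IsCSpace Y)
    (f : X → Y) (hf : Continuous f) (hopen : IsOpenMap f)
    (hdense : ∀ y : Y, ∀ x ∈ f ⁻¹' {y}, AccPt x (𝓟 (f ⁻¹' {y})))
    {G : Set X} (hG : IsOpen G) (hGf : f '' G = univ) :
    ∃ A : ℕ → Set X, (∀ n, IsOpen (A n) ∧ A n ⊆ G ∧ f '' A n = univ) ∧
      ∀ m n, m ≠ n → Disjoint (A m) (A n) := by
  have hs : ∀ G : {G : Set X // IsOpen G ∧ f '' G = univ},
      ∃ P : {G : Set X // IsOpen G ∧ f '' G = univ} × {G : Set X // IsOpen G ∧ f '' G = univ},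
        P.1.1 ⊆ G.1 ∧ P.2.1 ⊆ G.1 ∧ Disjoint P.1.1 P.2.1 := by
    rintro ⟨G, h1, h2⟩
    obtain ⟨G0, G1, a, b, c, d, e, g, h⟩ := split_open hY f hf hopen hdense h1 h2
    exact ⟨⟨⟨G0, a, g⟩, ⟨G1, b, h⟩⟩, c, d, e⟩
  choose P hP0 hP1 hPd using hs
  let R : ℕ → {G : Set X // IsOpen G ∧ f '' G = univ} := fun n =>
    Nat.rec ⟨G, hG, hGf⟩ (fun _ r => (P r).2) n
  have hRs : ∀ n, R (n + 1) = (P (R n)).2 := fun n => rfl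
  have hanti : Antitone (fun n => (R n).1) := antitone_nat_of_succ_le fun n => by
    rw [hRs]; exact hP1 _
  have hlt : ∀ m n, m < n → Disjoint (P (R m)).1.1 (P (R n)).1.1 := by
    intro m n hmn
    refine (hPd (R m)).mono_right ((hP0 (R n)).trans ?_)
    rw [← hRs]
    exact hanti (Nat.succ_le_of_lt hmn)
  refine ⟨fun n => (P (R n)).1.1, fun n => ⟨(P (R n)).1.2.1, ?_, (P (R n)).1.2.2⟩, ?_⟩
  · exact (hP0 (R n)).trans (hanti (Nat.zero_le n))
  · intro m n hne
    rcases lt_or_gt_of_ne hne with h | h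
    · exact hlt m n h
    · exact (hlt n m h).symm

theorem approx {X Y : Type*} [MetricSpace X] [CompactSpace X] [TopologicalSpace Y]
    [CompactSpace Y] [T2Space Y] (hY : IsCSpace Y)
    (f : X → Y) (hf : Continuous f) (hopen : IsOpenMap f)
    (hdense : ∀ y : Y, ∀ x ∈ f ⁻¹' {y}, AccPt x (𝓟 (f ⁻¹' {y})))
    (H : Hyper X) (hH : f '' H.carrier = univ) {δ ε : ℝ} (hδ : 0 < δ) (hε : 0 < ε) :
    ∃ H' : Hyper X, f '' H'.carrier = univ ∧ H'.carrier ⊆ Metric.thickening δ H.carrier ∧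
      H.carrier ⊆ Metric.thickening δ H'.carrier ∧ SmallOpen ε H'.carrier := by
  classical
  have hsub : H.carrier ⊆ Metric.thickening δ H.carrier := Metric.self_subset_thickening hδ _
  obtain ⟨A, hA, hAd⟩ := disjoint_seq hY f hf hopen hdense
    (G := Metric.thickening δ H.carrier) Metric.isOpen_thickening
    (univ_subset_iff.1 (hH ▸ image_mono hsub))
  obtain ⟨I, B, K, hI, hcov, hdis⟩ := cspace_selection hY f hopen
    (fun n B => closure B ⊆ A n ∧ ∀ a ∈ closure B, ∀ b ∈ closure B, dist a b ≤ ε / 4)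
    (fun n y => exists_small_ball f (hA n).1 (hA n).2.2 (by linarith) y)
  let Q : ℕ × Set Y → Set X := fun i => closure (B i) ∩ f ⁻¹' K i
  have hQcl : ∀ i ∈ I, IsClosed (Q i) := fun i hi =>
    isClosed_closure.inter ((hI i hi).2.2.1.preimage hf)
  set C : Set X := ⋃ i ∈ I, Q i with hC
  have hCcl : IsClosed C := I.finite_toSet.isClosed_biUnion fun i hi => hQcl i hi
  obtain ⟨F, hFH, hFfin, hFc⟩ := H.isClosed'.isCompact.finite_cover_balls hδ
  have hFc' : ∀ x ∈ H.carrier, ∃ z ∈ F, dist x z < δ := by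
    intro x hx
    obtain ⟨z, hz, hd⟩ := mem_iUnion₂.1 (hFc hx)
    exact ⟨z, hz, hd⟩
  have hne : (C ∪ F).Nonempty := by
    obtain ⟨x, hx⟩ := H.nonempty'
    obtain ⟨z, hz, -⟩ := hFc' x hx
    exact ⟨z, Or.inr hz⟩
  refine ⟨⟨C ∪ F, hCcl.union hFfin.isClosed, hne⟩, ?_, ?_, ?_, ?_⟩
  · refine eq_univ_of_forall fun y => ?_
    obtain ⟨i, hi, hy⟩ := hcov y
    obtain ⟨x, hx, rfl⟩ := (hI i hi).2.2.2 (interior_subset hy)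
    exact ⟨x, Or.inl (mem_iUnion₂.2 ⟨i, hi, subset_closure hx, interior_subset (s := K i) hy⟩), rfl⟩
  · refine union_subset (iUnion₂_subset fun i hi => ?_) (hFH.trans hsub)
    exact inter_subset_left.trans ((hI i hi).2.1.1.trans (hA i.1).2.1)
  · intro x hx
    obtain ⟨z, hz, hd⟩ := hFc' x hx
    exact Metric.mem_thickening_iff.2 ⟨z, Or.inr hz, hd⟩
  · have hQd : ∀ i ∈ I, ∀ j ∈ I, i ≠ j → Disjoint (Q i) (Q j) := by
      intro i hi j hj hij
      by_cases hl : i.1 = j.1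
      · exact ((hdis i hi j hj hij hl).preimage f).mono inter_subset_right inter_subset_right
      · exact (hAd _ _ hl).mono (inter_subset_left.trans (hI i hi).2.1.1)
          (inter_subset_left.trans (hI j hj).2.1.1)
    refine smallOpen_of_closed hε (Q '' (I : Set (ℕ × Set Y)) ∪ (fun x => {x}) '' (F \ C))
      ((I.finite_toSet.image _).union ((hFfin.subset sdiff_subset).image _)) ?_ ?_ ?_ ?_
    · rintro _ (⟨i, hi, rfl⟩ | ⟨x, hx, rfl⟩)
      · exact hQcl i hi
      · exact isClosed_singleton
    · have hQx : ∀ i ∈ I, ∀ x ∈ F \ C, Disjoint (Q i) {x} := by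
        intro i hi x hx
        rw [Set.disjoint_singleton_right]
        exact fun h => hx.2 (mem_iUnion₂.2 ⟨i, hi, h⟩)
      rintro _ (⟨i, hi, rfl⟩ | ⟨x, hx, rfl⟩) _ (⟨j, hj, rfl⟩ | ⟨z, hz, rfl⟩) hne
      · exact hQd i hi j hj fun h => hne (by rw [h])
      · exact hQx i hi z hz
      · exact (hQx j hj x hx).symm
      · rw [Set.disjoint_singleton]
        exact fun h => hne (by rw [h])
    · rintro _ (⟨i, hi, rfl⟩ | ⟨x, hx, rfl⟩) a ha b hb
      · have := (hI i hi).2.1.2 a ha.1 b hb.1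
        linarith
      · rw [mem_singleton_iff.1 ha, mem_singleton_iff.1 hb, dist_self]
        linarith
    · rintro x (hx | hx)
      · obtain ⟨i, hi, hxi⟩ := mem_iUnion₂.1 hx
        exact ⟨_, Or.inl ⟨i, hi, rfl⟩, hxi⟩
      · by_cases hxC : x ∈ C
        · obtain ⟨i, hi, hxi⟩ := mem_iUnion₂.1 hxC
          exact ⟨_, Or.inl ⟨i, hi, rfl⟩, hxi⟩
        · exact ⟨_, Or.inr ⟨x, ⟨hx, hxC⟩, rfl⟩, rfl⟩

theorem statement18 {X Y : Type*} [TopologicalSpace X] [CompactSpace X]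
    [TopologicalSpace.MetrizableSpace X]
    [TopologicalSpace Y] [TopologicalSpace.MetrizableSpace Y] (hY : IsCSpace Y)
    (f : X → Y) (hf : Continuous f) (hopen : IsOpenMap f) (hsurj : Function.Surjective f)
    (hdense : ∀ y : Y, ∀ x ∈ f ⁻¹' {y}, AccPt x (𝓟 (f ⁻¹' {y}))) :
    Dense {H : ↥{S : Hyper X | f '' S.carrier = Set.univ} |
        CovDimZero ↥(H : Hyper X).carrier} ∧
      IsGδ {H : ↥{S : Hyper X | f '' S.carrier = Set.univ} |
        CovDimZero ↥(H : Hyper X).carrier} := by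
  letI : MetricSpace X := TopologicalSpace.metrizableSpaceMetric X
  haveI : CompactSpace Y := hsurj.compactSpace hf
  haveI := Hyper.compactSpace X
  haveI := Hyper.t2Space X
  have hclosed : IsClosed {S : Hyper X | f '' S.carrier = Set.univ} := by
    have : {S : Hyper X | f '' S.carrier = Set.univ} =
        ⋂ y : Y, {S : Hyper X | S.carrier ⊆ (f ⁻¹' {y})ᶜ}ᶜ := by
      ext S
      simp only [mem_ofPred_eq, mem_iInter, mem_compl_iff, eq_univ_iff_forall]
      refine forall_congr' fun y => ?_
      constructor
      · rintro ⟨x, hx, rfl⟩ h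
        exact h hx rfl
      · intro h
        by_contra hy
        exact h fun x hx hxy => hy ⟨x, hx, hxy⟩
    rw [this]
    exact isClosed_iInter fun y => (Hyper.isOpen_subset
      (isClosed_singleton.preimage hf).isOpen_compl).isClosed_compl
  haveI : CompactSpace ↥{S : Hyper X | f '' S.carrier = Set.univ} :=
    isCompact_iff_compactSpace.1 hclosed.isCompact
  let U : ℕ → Set ↥{S : Hyper X | f '' S.carrier = Set.univ} := fun n =>
    {H | SmallOpen (1 / ((n : ℝ) + 1)) (H : Hyper X).carrier}
  have hU : ∀ n, IsOpen (U n) := fun n =>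
    (isOpen_smallOpen (1 / ((n : ℝ) + 1))).preimage continuous_subtype_val
  have hD : ∀ n, Dense (U n) := by
    intro n
    refine dense_iff_inter_open.2 ?_
    rintro T hT ⟨H, hH⟩
    obtain ⟨T', hT', rfl⟩ := isOpen_induced_iff.1 hT
    obtain ⟨δ, hδ, h⟩ := Hyper.exists_delta hT' H.1 hH
    obtain ⟨H', a, b, c, d⟩ := approx hY f hf hopen hdense H.1 H.2 hδ
      (show (0 : ℝ) < 1 / ((n : ℝ) + 1) from Nat.one_div_pos_of_nat)
    exact ⟨⟨H', a⟩, h H' b c, d⟩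
  have heq : {H : ↥{S : Hyper X | f '' S.carrier = Set.univ} |
      CovDimZero ↥(H : Hyper X).carrier} = ⋂ n, U n := by
    ext H
    rw [mem_iInter]
    constructor
    · intro h n
      exact smallOpen_of_covDimZero (H : Hyper X).isClosed' h Nat.one_div_pos_of_nat
    · intro h
      exact covDimZero_of_smallOpen (H : Hyper X).isClosed' h
  rw [heq]
  exact ⟨dense_iInter_of_isOpen hU hD, IsGδ.iInter_of_isOpen hU⟩
end
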